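/- Let a = a(ε) ≥ 0 be bounded as ε → 0 with a₀ := lim_{ε→0} a(ε) existing, let v_{ε,a} be a global minimizer of E, let ρ > 0 be the zero of μ_rad and μ₁ := μ_rad'(ρ) < 0. For ξ = ρe^{iθ}, using coordinates s = (s₁,s₂) in the basis (e^{iθ}, ie^{iθ}), define the rescaled minimizers w_{ε,a}(s) = 2^{-1/2}(−μ₁ε)^{-1/3} v_{ε,a}(ξ + ε^{2/3} s/(−μ₁)^{1/3}). Then as ε → 0, up to a subsequence, w_{ε,a} converges in C²_loc(ℝ²,ℝ²) to a solution y of the generalized second Painlevé equation Δy(s) − s₁ y(s) − 2|y(s)|² y(s) − α = 0 on ℝ², with α = lim_{ε→0} a(ε) f(ξ)/(√2 μ₁), and this limit y is bounded on every half-plane [s₀,∞) × ℝ. -/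

import Mathlib

open MeasureTheory Filter Real Set
open scoped Topology ENNReal

noncomputable section

/-- We identify the plane with the Euclidean space `ℝ²`. -/
abbrev E2 : Type := EuclideanSpace ℝ (Fin 2)

/-- The standard basis vectors of `ℝ²`. -/
def e2basis (i : Fin 2) : E2 := EuclideanSpace.single i 1

/-- Rotation of a vector by `π/2` (multiplication by `i` in complex notation). -/
def perp (e : E2) : E2 := EuclideanSpace.single 0 (-(e 1)) + EuclideanSpace.single 1 (e 0)

/-- The unit vector `e^{iθ}`. -/
def uvec (θ : ℝ) : E2 := EuclideanSpace.single 0 (Real.cos θ) + EuclideanSpace.single 1 (Real.sin θ)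

/-- The Laplacian of a map `u : ℝ² → ℝ²`. -/
def lap (u : E2 → E2) (x : E2) : E2 :=
  ∑ i : Fin 2, fderiv ℝ (fun y => fderiv ℝ u y (e2basis i)) x (e2basis i)

/-- `|∇u|²`, the squared Hilbert-Schmidt norm of the full gradient of `u : ℝ² → ℝ²`. -/
def gradSq (u : E2 → E2) (x : E2) : ℝ := ∑ i : Fin 2, ‖fderiv ℝ u x (e2basis i)‖ ^ 2

/-- `∑_j ∇u_j · ∇ψ_j`, the Hilbert-Schmidt inner product of the gradients. -/
def gradInner (u ψ : E2 → E2) (x : E2) : ℝ :=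
  ∑ i : Fin 2, (inner ℝ (fderiv ℝ u x (e2basis i)) (fderiv ℝ ψ x (e2basis i)) : ℝ)

/-- Membership in `H¹(ℝ²,ℝ²)`: `u ∈ L²` together with its gradient. -/
def MemH1 (u : E2 → E2) : Prop :=
  Differentiable ℝ u ∧ MemLp u 2 (volume : Measure E2) ∧
    MemLp (fun x => fderiv ℝ u x) 2 (volume : Measure E2)

/-- The Ginzburg–Landau energy
`E(u) = ∫ (1/2)|∇u|² − (1/(2ε²))μ|u|² + (1/(4ε²))|u|⁴ − (a/ε) f·u`. -/
def energy (ε a : ℝ) (μ : E2 → ℝ) (f : E2 → E2) (u : E2 → E2) : ℝ :=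
  ∫ x : E2, ((1/2) * gradSq u x - (1/(2*ε^2)) * μ x * ‖u x‖^2
    + (1/(4*ε^2)) * ‖u x‖^4 - (a/ε) * (inner ℝ (f x) (u x) : ℝ))

/-- `v` is a global minimizer of `E` over `H¹(ℝ²,ℝ²)`. -/
def IsMinimizer (ε a : ℝ) (μ : E2 → ℝ) (f : E2 → E2) (v : E2 → E2) : Prop :=
  MemH1 v ∧ ∀ u : E2 → E2, MemH1 u → energy ε a μ f v ≤ energy ε a μ f u

/-- `u` is a smooth classical solution of the Euler–Lagrange equation
`ε²Δu + μu − |u|²u + εa f = 0` on `ℝ²`. -/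
def IsSolution (ε a : ℝ) (μ : E2 → ℝ) (f : E2 → E2) (u : E2 → E2) : Prop :=
  ContDiff ℝ (⊤ : ℕ∞) u ∧ ∀ x : E2, ε^2 • lap u x + μ x • u x - ‖u x‖^2 • u x + (ε*a) • f x = 0

/-- Hypotheses on the radial coefficient `μ`. -/
structure MuHyp (μ : E2 → ℝ) (μrad : ℝ → ℝ) (ρ : ℝ) : Prop where
  smooth : ContDiff ℝ (⊤ : ℕ∞) μ
  smooth_rad : ContDiff ℝ (⊤ : ℕ∞) μrad
  even_rad : ∀ r : ℝ, μrad (-r) = μrad r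
  radial : ∀ x : E2, μ x = μrad ‖x‖
  bdd : ∃ C : ℝ, ∀ x : E2, |μ x| ≤ C
  deriv_neg : ∀ r : ℝ, 0 < r → deriv μrad r < 0
  rho_pos : 0 < ρ
  rho_root : μrad ρ = 0
  rho_unique : ∀ r : ℝ, 0 < r → μrad r = 0 → r = ρ

/-- Hypotheses on the radial vector field `f`. -/
structure FHyp (f : E2 → E2) (frad : ℝ → ℝ) : Prop where
  smooth : ContDiff ℝ (⊤ : ℕ∞) f
  smooth_rad : ContDiff ℝ (⊤ : ℕ∞) frad
  odd_rad : ∀ r : ℝ, frad (-r) = -frad r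
  radial : ∀ x : E2, x ≠ 0 → f x = (frad ‖x‖ / ‖x‖) • x
  integrable : Integrable f (volume : Measure E2)
  bdd : ∃ C : ℝ, ∀ x : E2, ‖f x‖ ≤ C
  pos_rad : ∀ r : ℝ, 0 < r → 0 < frad r

/-- Convergence in `C²_loc(ℝ²,ℝ²)` of a sequence of maps. -/
def TendstoC2LocSeq (F : ℕ → E2 → E2) (g : E2 → E2) : Prop :=
  TendstoLocallyUniformly F g atTop ∧
  TendstoLocallyUniformly (fun n x => fderiv ℝ (F n) x) (fun x => fderiv ℝ g x) atTop ∧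
  TendstoLocallyUniformly (fun n x => fderiv ℝ (fderiv ℝ (F n)) x)
    (fun x => fderiv ℝ (fderiv ℝ g) x) atTop

/-- `l` is a limit point (as `ε → 0`) of the set of zeros of the family `v ε`. -/
def IsZeroLimitPoint (v : ℝ → E2 → E2) (l : E2) : Prop :=
  ∃ (εs : ℕ → ℝ) (xs : ℕ → E2), (∀ n, 0 < εs n) ∧ Tendsto εs atTop (𝓝 (0:ℝ)) ∧
    (∀ n, v (εs n) (xs n) = 0) ∧ Tendsto xs atTop (𝓝 l)

/-- Partial derivative. -/
def pd {V : Type*} [NormedAddCommGroup V] [NormedSpace ℝ V] (i : Fin 2) (u : E2 → V) (x : E2) : V :=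
  fderiv ℝ u x (e2basis i)

/-- Laplacian of a general vector-valued map. -/
def lapV {V : Type*} [NormedAddCommGroup V] [NormedSpace ℝ V] (u : E2 → V) (x : E2) : V :=
  ∑ i : Fin 2, pd i (pd i u) x

lemma second_deriv_nonpos {g g' : ℝ → ℝ} {t0 c : ℝ} (h : IsLocalMax g t0)
    (hg : ∀ t, HasDerivAt g (g' t) t) (hg' : HasDerivAt g' c t0) : c ≤ 0 := by
  by_contra hc
  push Not at hc
  have e1 : deriv g = g' := funext fun t => (hg t).deriv
  have h2 : IsLocalMin g t0 := by
    apply isLocalMin_of_deriv_deriv_pos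
    · rw [e1, hg'.deriv]; exact hc
    · exact h.deriv_eq_zero
    · exact (hg t0).continuousAt
  have h3 : g =ᶠ[𝓝 t0] fun _ => g t0 := by
    filter_upwards [h, h2] with t a b using le_antisymm a b
  have h4 : g' =ᶠ[𝓝 t0] fun _ => 0 := by
    have := h3.deriv
    rw [e1] at this
    simpa using this
  have := h4.deriv_eq
  rw [hg'.deriv] at this
  simp at this
  linarith

section basic
variable {V : Type*} [NormedAddCommGroup V] [NormedSpace ℝ V]

lemma norm_e2basis (i : Fin 2) : ‖e2basis i‖ = 1 := by simp [e2basis]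

lemma pd_contDiff {u : E2 → V} {n m : WithTop ℕ∞} (i : Fin 2) (hu : ContDiff ℝ n u) (h : m + 1 ≤ n) :
    ContDiff ℝ m (pd i u) :=
  (hu.fderiv_right h).clm_apply contDiff_const

lemma hasDerivAt_line {u : E2 → V} (hu : Differentiable ℝ u) (x h : E2) (t : ℝ) :
    HasDerivAt (fun t : ℝ => u (x + t • h)) (fderiv ℝ u (x + t • h) h) t := by
  have h1 : HasDerivAt (fun t : ℝ => x + t • h) h t := by
    simpa using ((hasDerivAt_id t).smul_const h).const_add x
  exact (hu _).hasFDerivAt.comp_hasDerivAt t h1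

lemma hasDerivAt_line_neg {u : E2 → V} (hu : Differentiable ℝ u) (x h : E2) (t : ℝ) :
    HasDerivAt (fun t : ℝ => u (x - t • h)) (-fderiv ℝ u (x - t • h) h) t := by
  have h1 : HasDerivAt (fun t : ℝ => x - t • h) (-h) t := by
    simpa using ((hasDerivAt_id t).smul_const h).const_sub x
  exact ((hu _).hasFDerivAt.comp_hasDerivAt t h1).congr_deriv (by simp)

end basic

lemma pd_pd_nonpos {u : E2 → ℝ} (hu : ContDiff ℝ 2 u) {x : E2} (h : IsLocalMax u x) (i : Fin 2) :
    pd i (pd i u) x ≤ 0 := by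
  have hd : Differentiable ℝ u := hu.differentiable (by norm_num)
  have hd' : Differentiable ℝ (pd i u) := (pd_contDiff (m := 1) i hu (by norm_num)).differentiable (by norm_num)
  apply second_deriv_nonpos (g := fun t : ℝ => u (x + t • e2basis i)) (t0 := 0)
    (g' := fun t => pd i u (x + t • e2basis i))
  · have hc : ContinuousAt (fun t : ℝ => x + t • e2basis i) 0 := by fun_prop
    have h' : IsLocalMax u (x + (0:ℝ) • e2basis i) := by simpa using h
    exact IsMaxFilter.comp_tendsto (g := fun t : ℝ => x + t • e2basis i) h' hc
  · intro t; exact hasDerivAt_line hd x _ t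
  · have := hasDerivAt_line hd' x (e2basis i) 0
    simpa [pd] using this

lemma lapV_nonpos {u : E2 → ℝ} (hu : ContDiff ℝ 2 u) {x : E2} (h : IsLocalMax u x) :
    lapV u x ≤ 0 := by
  have h0 := pd_pd_nonpos hu h 0
  have h1 := pd_pd_nonpos hu h 1
  simp only [lapV, Fin.sum_univ_two]; linarith

lemma grad_aux {u : E2 → ℝ} (hu : ContDiff ℝ 2 u) (x0 : E2) (M N : ℝ) (hN : 0 < N)
    (hM : ∀ x ∈ Metric.closedBall x0 2, |u x| ≤ M)
    (hL : ∀ x ∈ Metric.closedBall x0 2, |lapV u x| ≤ N) (i j : Fin 2) (hij : i ≠ j) :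
    pd i u x0 ≤ 2 * M + N := by
  have hM0 : 0 ≤ M := (abs_nonneg _).trans (hM x0 (by simp))
  have hd : Differentiable ℝ u := hu.differentiable (by norm_num)
  have hd' : ∀ k, Differentiable ℝ (pd k u) := fun k =>
    (pd_contDiff (m := 1) k hu (by norm_num)).differentiable (by norm_num)
  have hlap : ∀ x, lapV u x = pd j (pd j u) x + pd i (pd i u) x := by
    intro x
    simp only [lapV, Fin.sum_univ_two]
    fin_cases i <;> fin_cases j <;> simp_all [add_comm]
  set a := e2basis j with ha
  set b := e2basis i with hb
  have hmemp : ∀ p t : ℝ, p ∈ Icc (-1:ℝ) 1 → t ∈ Icc (0:ℝ) 1 →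
      x0 + p • a + t • b ∈ Metric.closedBall x0 2 ∧ x0 + p • a - t • b ∈ Metric.closedBall x0 2 := by
    intro p t hp ht
    have h1 : ‖p • a‖ ≤ 1 := by
      rw [norm_smul, ha, norm_e2basis, mul_one]; exact abs_le.2 ⟨hp.1, hp.2⟩
    have h2 : ‖t • b‖ ≤ 1 := by
      rw [norm_smul, hb, norm_e2basis, mul_one]; exact abs_le.2 ⟨by linarith [ht.1], ht.2⟩
    constructor
    · rw [mem_closedBall_iff_norm]
      have : x0 + p • a + t • b - x0 = p • a + t • b := by abel
      rw [this]; linarith [norm_add_le (p • a) (t • b)]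
    · rw [mem_closedBall_iff_norm]
      have : x0 + p • a - t • b - x0 = p • a - t • b := by abel
      rw [this]; linarith [norm_sub_le (p • a) (t • b)]
  let Φ : ℝ × ℝ → ℝ := fun q => (1/2) * (u (x0 + q.1 • a + q.2 • b) - u (x0 + q.1 • a - q.2 • b))
    - (M * (q.1 ^ 2 + q.2 * (2 - q.2)) + N * (q.2 * (1 - q.2)))
  have hΦc : Continuous Φ := by
    have := hu.continuous
    fun_prop
  have hcpt : IsCompact (Icc (-1:ℝ) 1 ×ˢ Icc (0:ℝ) 1) := isCompact_Icc.prod isCompact_Icc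
  obtain ⟨⟨p, t⟩, hpt, hmax⟩ := hcpt.exists_isMaxOn ⟨(0, 0), by simp⟩ hΦc.continuousOn
  have hp := hpt.1
  have ht := hpt.2
  simp only at hp ht
  have key : Φ (p, t) ≤ 0 := by
    by_contra hpos
    push Not at hpos
    have hup := hM _ (hmemp p t hp ht).1
    have hum := hM _ (hmemp p t hp ht).2
    rw [abs_le] at hup hum
    have hval : Φ (p, t) = (1/2) * (u (x0 + p • a + t • b) - u (x0 + p • a - t • b))
      - (M * (p ^ 2 + t * (2 - t)) + N * (t * (1 - t))) := rfl
    have ht0 : t ≠ 0 := by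
      rintro rfl
      rw [hval] at hpos
      simp at hpos
      nlinarith [sq_nonneg p]
    have hNt : 0 ≤ N * (t * (1 - t)) := mul_nonneg hN.le (mul_nonneg ht.1 (by linarith [ht.2]))
    have ht1 : t ≠ 1 := by
      rintro rfl
      rw [hval] at hpos
      nlinarith [mul_nonneg hM0 (sq_nonneg p)]
    have hp1 : p ^ 2 ≠ 1 := by
      intro h
      rw [hval, h] at hpos
      have : 0 ≤ M * (t * (2 - t)) := mul_nonneg hM0 (mul_nonneg ht.1 (by linarith [ht.2]))
      nlinarith
    have hpo : p ∈ Ioo (-1:ℝ) 1 := by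
      constructor
      · rcases hp.1.lt_or_eq with h | h
        · exact h
        · exact absurd (by rw [← h]; norm_num) hp1
      · rcases hp.2.lt_or_eq with h | h
        · exact h
        · exact absurd (by rw [h]; norm_num) hp1
    have hto : t ∈ Ioo (0:ℝ) 1 := ⟨lt_of_le_of_ne ht.1 (Ne.symm ht0), lt_of_le_of_ne ht.2 ht1⟩
    -- p section
    have hpp : (1/2) * (pd j (pd j u) (x0 + p • a + t • b) - pd j (pd j u) (x0 + p • a - t • b)) - 2 * M ≤ 0 := by
      apply second_deriv_nonpos (g := fun p => Φ (p, t)) (t0 := p)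
        (g' := fun p => (1/2) * (pd j u (x0 + p • a + t • b) - pd j u (x0 + p • a - t • b)) - 2 * M * p)
      · filter_upwards [Ioo_mem_nhds hpo.1 hpo.2] with s hs
        exact hmax ⟨⟨hs.1.le, hs.2.le⟩, ht⟩
      · intro s
        have h1 := hasDerivAt_line hd (x0 + t • b) a s
        have h2 := hasDerivAt_line hd (x0 - t • b) a s
        have h3 := ((h1.sub h2).const_mul (1/2)).sub
          ((((hasDerivAt_pow 2 s).add_const (t * (2 - t))).const_mul M).add_const (N * (t * (1 - t))))
        have e1 : ∀ s : ℝ, x0 + t • b + s • a = x0 + s • a + t • b := fun s => by abel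
        have e2 : ∀ s : ℝ, x0 - t • b + s • a = x0 + s • a - t • b := fun s => by abel
        simp only [e1, e2] at h3
        refine h3.congr_deriv ?_
        simp only [pd, ← ha]
        push_cast; ring
      · have h1 := hasDerivAt_line (hd' j) (x0 + t • b) a p
        have h2 := hasDerivAt_line (hd' j) (x0 - t • b) a p
        have h3 := ((h1.sub h2).const_mul (1/2)).sub ((hasDerivAt_id p).const_mul (2 * M))
        have e1 : ∀ s : ℝ, x0 + t • b + s • a = x0 + s • a + t • b := fun s => by abel
        have e2 : ∀ s : ℝ, x0 - t • b + s • a = x0 + s • a - t • b := fun s => by abel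
        simp only [e1, e2] at h3
        refine h3.congr_deriv ?_
        rw [mul_one]; rfl
    have htt : (1/2) * (pd i (pd i u) (x0 + p • a + t • b) - pd i (pd i u) (x0 + p • a - t • b)) + 2 * M + 2 * N ≤ 0 := by
      apply second_deriv_nonpos (g := fun t => Φ (p, t)) (t0 := t)
        (g' := fun t => (1/2) * (pd i u (x0 + p • a + t • b) + pd i u (x0 + p • a - t • b))
          - (M * (2 - 2 * t) + N * (1 - 2 * t)))
      · filter_upwards [Ioo_mem_nhds hto.1 hto.2] with s hs
        exact hmax ⟨hp, ⟨hs.1.le, hs.2.le⟩⟩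
      · intro s
        have h1 := hasDerivAt_line hd (x0 + p • a) b s
        have h2 := hasDerivAt_line_neg hd (x0 + p • a) b s
        have q1 : HasDerivAt (fun s : ℝ => M * (p ^ 2 + s * (2 - s)) + N * (s * (1 - s)))
            (M * (2 - 2 * s) + N * (1 - 2 * s)) s := by
          have := (((((hasDerivAt_id s).mul ((hasDerivAt_id s).const_sub 2))).const_add (p^2)).const_mul M).add
            (((hasDerivAt_id s).mul ((hasDerivAt_id s).const_sub 1)).const_mul N)
          refine this.congr_deriv ?_
          simp; ring
        have h3 := ((h1.sub h2).const_mul (1/2)).sub q1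
        refine h3.congr_deriv ?_
        simp only [pd, ← hb]
        ring
      · have h1 := hasDerivAt_line (hd' i) (x0 + p • a) b t
        have h2 := hasDerivAt_line_neg (hd' i) (x0 + p • a) b t
        have q1 : HasDerivAt (fun s : ℝ => M * (2 - 2 * s) + N * (1 - 2 * s)) (-2 * M - 2 * N) t := by
          have := ((((hasDerivAt_id t).const_mul 2).const_sub 2).const_mul M).add
            ((((hasDerivAt_id t).const_mul 2).const_sub 1).const_mul N)
          refine this.congr_deriv ?_
          ring
        have h3 := ((h1.add h2).const_mul (1/2)).sub q1
        refine h3.congr_deriv ?_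
        simp only [pd, ← hb]
        ring
    have l1 := hL _ (hmemp p t hp ht).1
    have l2 := hL _ (hmemp p t hp ht).2
    rw [abs_le, hlap] at l1 l2
    linarith [l1.1, l2.2]
  -- conclude
  have hle : ∀ s ∈ Ioo (0:ℝ) 1, (1/2) * (u (x0 + s • b) - u (x0 - s • b)) ≤ s * (2 * M + N) := by
    intro s hs
    have h1 : Φ (0, s) ≤ 0 := (hmax ⟨by simp, ⟨hs.1.le, hs.2.le⟩⟩).trans key
    have h2 : Φ (0, s) = (1/2) * (u (x0 + s • b) - u (x0 - s • b))
      - (M * (0 ^ 2 + s * (2 - s)) + N * (s * (1 - s))) := by simp [Φ]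
    rw [h2] at h1
    nlinarith [mul_nonneg hM0 (sq_nonneg s), mul_nonneg hN.le (sq_nonneg s)]
  have hder : HasDerivAt (fun s : ℝ => (1/2) * (u (x0 + s • b) - u (x0 - s • b))) (pd i u x0) 0 := by
    have h3 := ((hasDerivAt_line hd x0 b 0).sub (hasDerivAt_line_neg hd x0 b 0)).const_mul (1/2)
    refine h3.congr_deriv ?_
    simp [pd, ← hb]
    ring
  have hs := (hasDerivWithinAt_iff_tendsto_slope (s := Ioi 0)).1 hder.hasDerivWithinAt
  have hs' : Tendsto (slope (fun s : ℝ => (1/2) * (u (x0 + s • b) - u (x0 - s • b))) 0) (𝓝[>] 0) (𝓝 (pd i u x0)) := by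
    simpa using hs
  refine le_of_tendsto hs' ?_
  filter_upwards [Ioo_mem_nhdsGT (show (0:ℝ) < 1 by norm_num)] with s hs
  rw [slope_def_field, div_le_iff₀ (by simpa using hs.1)]
  have := hle s hs
  simp at this ⊢
  linarith

lemma grad_est {u : E2 → ℝ} (hu : ContDiff ℝ 2 u) (x0 : E2) (M N : ℝ) (hN : 0 < N)
    (hM : ∀ x ∈ Metric.closedBall x0 2, |u x| ≤ M)
    (hL : ∀ x ∈ Metric.closedBall x0 2, |lapV u x| ≤ N) (i : Fin 2) :
    |pd i u x0| ≤ 2 * M + N := by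
  obtain ⟨j, hij⟩ : ∃ j : Fin 2, i ≠ j := ⟨1 - i, by fin_cases i <;> simp⟩
  have e1 : ∀ k, pd k (fun x => - u x) = fun x => - pd k u x := by
    intro k; funext x
    simp [pd, fderiv_fun_neg]
  have e2 : ∀ k (w : E2 → ℝ), pd k (fun x => - w x) = fun x => - pd k w x := by
    intro k w; funext x
    simp [pd, fderiv_fun_neg]
  have h1 := grad_aux hu x0 M N hN hM hL i j hij
  have h2 := grad_aux (u := fun x => - u x) hu.neg x0 M N hN (by simpa using hM) (by
    intro x hx
    have : lapV (fun x => - u x) x = - lapV u x := by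
      simp only [lapV, e1, e2, Fin.sum_univ_two]; ring
    rw [this, abs_neg]; exact hL x hx) i j hij
  rw [e1] at h2
  rw [abs_le]; constructor <;> linarith

lemma pd_mul {f g : E2 → ℝ} (hf : Differentiable ℝ f) (hg : Differentiable ℝ g) (i : Fin 2) :
    pd i (fun x => f x * g x) = fun x => f x * pd i g x + pd i f x * g x := by
  funext x
  simp only [pd, fderiv_fun_mul (hf x) (hg x)]
  simp [mul_comm]

lemma pd_add {V : Type*} [NormedAddCommGroup V] [NormedSpace ℝ V] {f g : E2 → V}
    (hf : Differentiable ℝ f) (hg : Differentiable ℝ g) (i : Fin 2) :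
    pd i (fun x => f x + g x) = fun x => pd i f x + pd i g x := by
  funext x
  simp only [pd, fderiv_fun_add (hf x) (hg x)]
  simp

lemma pd_const_mul {f : E2 → ℝ} (hf : Differentiable ℝ f) (c : ℝ) (i : Fin 2) :
    pd i (fun x => c * f x) = fun x => c * pd i f x := by
  funext x
  simp only [pd, fderiv_const_mul (hf x) c]
  simp

lemma pd_inner {f g : E2 → E2} (hf : Differentiable ℝ f) (hg : Differentiable ℝ g) (i : Fin 2) :
    pd i (fun x => (inner ℝ (f x) (g x) : ℝ)) =
      fun x => (inner ℝ (f x) (pd i g x) : ℝ) + inner ℝ (pd i f x) (g x) := by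
  funext x
  simp only [pd, fderiv_inner_apply ℝ (hf x) (hg x)]

lemma pd_m (x0 : E2) (i : Fin 2) :
    pd i (fun x : E2 => 1 - ‖x - x0‖ ^ 2) = fun x => -2 * (x i - x0 i) := by
  have h : (fun x : E2 => 1 - ‖x - x0‖ ^ 2) = fun x => 1 + (-1) * (inner ℝ (x - x0) (x - x0) : ℝ) := by
    funext x; rw [real_inner_self_eq_norm_sq]; ring
  have hd : Differentiable ℝ (fun x : E2 => x - x0) := by fun_prop
  have hp : pd i (fun x : E2 => x - x0) = fun _ => e2basis i := by
    funext x; simp [pd, fderiv_sub_const]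
  have hi : Differentiable ℝ (fun x : E2 => (inner ℝ (x - x0) (x - x0) : ℝ)) := hd.inner ℝ hd
  rw [h, pd_add (by fun_prop) (hi.const_mul _), pd_const_mul hi, pd_inner hd hd, hp]
  funext x
  simp [pd, e2basis, EuclideanSpace.inner_single_left, EuclideanSpace.inner_single_right]
  ring

lemma pd_coord (x0 : E2) (i : Fin 2) :
    pd i (fun x : E2 => -2 * (x i - x0 i)) = fun _ => -2 := by
  have hd : Differentiable ℝ (fun x : E2 => x i - x0 i) := by fun_prop
  rw [pd_const_mul hd]
  funext x
  have : HasFDerivAt (fun x : E2 => x i - x0 i) (EuclideanSpace.proj i : E2 →L[ℝ] ℝ) x :=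
    (EuclideanSpace.proj i : E2 →L[ℝ] ℝ).hasFDerivAt.sub_const _
  simp [pd, this.fderiv, e2basis]

lemma keller_osserman {u : E2 → E2} (hu : ContDiff ℝ 2 u) (x0 : E2) (c : E2 → ℝ) (h : E2 → E2)
    (M H : ℝ) (hM : 0 ≤ M) (hH : 0 ≤ H)
    (heq : ∀ x ∈ Metric.ball x0 1, lapV u x = c x • u x + (2 * ‖u x‖ ^ 2) • u x + h x)
    (hc : ∀ x ∈ Metric.ball x0 1, -M ≤ c x) (hh : ∀ x ∈ Metric.ball x0 1, ‖h x‖ ≤ H) :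
    ‖u x0‖ ^ 2 ≤ 7 + M + H := by
  by_contra hcon
  push Not at hcon
  have hd : Differentiable ℝ u := hu.differentiable (by norm_num)
  have hd' : ∀ k, Differentiable ℝ (pd k u) := fun k =>
    (pd_contDiff (m := 1) k hu (by norm_num)).differentiable (by norm_num)
  let q : E2 → ℝ := fun x => inner ℝ (u x) (u x)
  let m : E2 → ℝ := fun x => 1 - ‖x - x0‖ ^ 2
  let Z : E2 → ℝ := fun x => q x * (m x * m x)
  have hq2 : ContDiff ℝ 2 q := hu.inner ℝ hu
  have hm2 : ContDiff ℝ 2 m := by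
    have : ContDiff ℝ 2 (fun x : E2 => ‖x - x0‖ ^ 2) := (contDiff_id.sub contDiff_const).norm_sq ℝ
    exact contDiff_const.sub this
  have hZ2 : ContDiff ℝ 2 Z := hq2.mul (hm2.mul hm2)
  have hqd : Differentiable ℝ q := hq2.differentiable (by norm_num)
  have hmd : Differentiable ℝ m := hm2.differentiable (by norm_num)
  have hqn : ∀ x, q x = ‖u x‖ ^ 2 := fun x => real_inner_self_eq_norm_sq _
  obtain ⟨x, hx, hmax⟩ := (isCompact_closedBall x0 1).exists_isMaxOn ⟨x0, by simp⟩ hZ2.continuous.continuousOn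
  have hZ0 : Z x0 = ‖u x0‖ ^ 2 := by simp [Z, m, hqn]
  have hZx : ‖u x0‖ ^ 2 ≤ Z x := by rw [← hZ0]; exact hmax (by simp)
  have hxle : ‖x - x0‖ ≤ 1 := mem_closedBall_iff_norm.1 hx
  have hxlt : ‖x - x0‖ < 1 := by
    rcases hxle.lt_or_eq with h' | h'
    · exact h'
    · exfalso
      have : Z x = 0 := by simp [Z, m, h']
      nlinarith
  have hxb : x ∈ Metric.ball x0 1 := mem_ball_iff_norm.2 hxlt
  have hloc : IsLocalMax Z x := by
    filter_upwards [Metric.isOpen_ball.mem_nhds hxb] with y hy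
    exact hmax (Metric.ball_subset_closedBall hy)
  have hlap := lapV_nonpos hZ2 hloc
  have hm0 : 0 < m x := by
    have := norm_nonneg (x - x0)
    simp only [m]; nlinarith
  have hm1 : m x ≤ 1 := by simp only [m]; nlinarith [sq_nonneg ‖x - x0‖]
  have hpm : ∀ i, pd i m = fun x => -2 * (x i - x0 i) := pd_m x0
  have hpmd : ∀ i, Differentiable ℝ (pd i m) := by intro i; rw [hpm]; fun_prop
  have hpq : ∀ i, pd i q = fun x => 2 * inner ℝ (u x) (pd i u x) := by
    intro i
    rw [show q = fun x => inner ℝ (u x) (u x) from rfl, pd_inner hd hd]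
    funext x; rw [real_inner_comm (u x) (pd i u x)]; ring
  have hpqd : ∀ i, Differentiable ℝ (pd i q) := by
    intro i; rw [hpq]
    exact ((hd.inner ℝ (hd' i))).const_mul 2
  have hpqq : ∀ i, pd i (pd i q) x = 2 * ‖pd i u x‖ ^ 2 + 2 * inner ℝ (u x) (pd i (pd i u) x) := by
    intro i
    rw [hpq, pd_const_mul (hd.inner ℝ (hd' i)), pd_inner hd (hd' i), ← real_inner_self_eq_norm_sq]
    ring
  have hpZ : ∀ i, pd i Z = fun x => q x * (m x * pd i m x + pd i m x * m x) + pd i q x * (m x * m x) := by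
    intro i
    have hd4 : Differentiable ℝ (fun x => m x * m x) := hmd.mul hmd
    rw [show Z = fun x => q x * (m x * m x) from rfl, pd_mul hqd hd4, pd_mul hmd hmd]
  have hpZZ : ∀ i, pd i (pd i Z) x = q x * ((m x * (-2) + pd i m x * pd i m x) + (pd i m x * pd i m x + (-2) * m x))
      + pd i q x * (m x * pd i m x + pd i m x * m x)
      + (pd i q x * (m x * pd i m x + pd i m x * m x) + pd i (pd i q) x * (m x * m x)) := by
    intro i
    have hd1 : Differentiable ℝ (fun x => m x * pd i m x) := hmd.mul (hpmd i)
    have hd2 : Differentiable ℝ (fun x => pd i m x * m x) := (hpmd i).mul hmd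
    have hd4 : Differentiable ℝ (fun x => m x * m x) := hmd.mul hmd
    have hmm : pd i (pd i m) = fun _ => -2 := by rw [hpm]; exact pd_coord x0 i
    have hd3 : Differentiable ℝ (fun x => m x * pd i m x + pd i m x * m x) := hd1.add hd2
    have hd5 : Differentiable ℝ (fun x => q x * (m x * pd i m x + pd i m x * m x)) := hqd.mul (hd1.add hd2)
    have hd6 : Differentiable ℝ (fun x => pd i q x * (m x * m x)) := (hpqd i).mul hd4
    rw [hpZ, pd_add hd5 hd6,
      pd_mul hqd hd3, pd_mul (hpqd i) hd4, pd_add hd1 hd2, pd_mul hmd (hpmd i), pd_mul (hpmd i) hmd,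
      pd_mul hmd hmd, hmm]
  have hcrit : ∀ i, pd i Z x = 0 := by
    intro i; simp [pd, hloc.fderiv_eq_zero]
  have hcr : ∀ i, m x * pd i q x = 4 * q x * (x i - x0 i) := by
    intro i
    have := hcrit i
    rw [hpZ] at this
    simp only [hpm] at this
    have h2 : m x * (m x * pd i q x - 4 * q x * (x i - x0 i)) = 0 := by linarith
    rcases mul_eq_zero.1 h2 with h3 | h3
    · exact absurd h3 hm0.ne'
    · linarith
  have hr : ‖x - x0‖ ^ 2 = (x 0 - x0 0) ^ 2 + (x 1 - x0 1) ^ 2 := by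
    rw [EuclideanSpace.norm_sq_eq]; simp [Fin.sum_univ_two]
  have hlapq : lapV q x ≥ 4 * q x ^ 2 - 2 * M * q x - 2 * H * ‖u x‖ := by
    have e1 : lapV q x = 2 * (‖pd 0 u x‖ ^ 2 + ‖pd 1 u x‖ ^ 2) + 2 * inner ℝ (u x) (lapV u x) := by
      simp only [lapV, Fin.sum_univ_two, hpqq, inner_add_right]; ring
    rw [e1, heq x hxb]
    simp only [inner_add_right, real_inner_smul_right, real_inner_self_eq_norm_sq, ← hqn]
    have a1 : -(H * ‖u x‖) ≤ inner ℝ (u x) (h x) := by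
      have := abs_le.1 (abs_real_inner_le_norm (u x) (h x))
      have h3 : ‖u x‖ * ‖h x‖ ≤ ‖u x‖ * H := mul_le_mul_of_nonneg_left (hh x hxb) (norm_nonneg _)
      linarith [this.1]
    have a2 : -M * q x ≤ c x * q x :=
      mul_le_mul_of_nonneg_right (hc x hxb) (by rw [hqn]; positivity)
    nlinarith [sq_nonneg ‖pd 0 u x‖, sq_nonneg ‖pd 1 u x‖]
  have hlapZ : lapV Z x = m x * m x * lapV q x - 32 * q x * ‖x - x0‖ ^ 2 + q x * (8 * ‖x - x0‖ ^ 2 - 8 * m x) := by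
    simp only [lapV, Fin.sum_univ_two, hpZZ, hr]
    have c0 := hcr 0
    have c1 := hcr 1
    simp only [hpm]
    linear_combination (-8 * (x 0 - x0 0)) * c0 + (-8 * (x 1 - x0 1)) * c1
  have hq1 : 1 ≤ q x := by
    have hZq : Z x ≤ q x := by
      have : m x * m x ≤ 1 := by nlinarith
      have h0 : 0 ≤ q x := by rw [hqn]; positivity
      simp only [Z]; nlinarith
    linarith
  have hun : ‖u x‖ ≤ q x := by
    rw [hqn] at hq1 ⊢
    have := norm_nonneg (u x)
    nlinarith
  rw [hlapZ] at hlap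
  have hms : m x = 1 - ‖x - x0‖ ^ 2 := rfl
  have f1 : m x * m x * lapV q x ≤ 24 * q x := by
    have : ‖x - x0‖ ^ 2 ≤ 1 := by nlinarith [norm_nonneg (x - x0)]
    rw [hms] at hlap ⊢
    nlinarith
  have f2 : m x * m x * (4 * q x ^ 2 - 2 * M * q x - 2 * H * ‖u x‖) ≤ 24 * q x :=
    (mul_le_mul_of_nonneg_left hlapq (by positivity)).trans f1
  have hmm1 : m x * m x ≤ 1 := by nlinarith
  have f3 : m x * m x * (4 * q x ^ 2) ≤ (24 + 2 * M + 2 * H) * q x := by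
    have g1 : m x * m x * (2 * M * q x) ≤ 1 * (2 * M * q x) :=
      mul_le_mul_of_nonneg_right hmm1 (by positivity)
    have g2 : m x * m x * (2 * H * ‖u x‖) ≤ 1 * (2 * H * ‖u x‖) :=
      mul_le_mul_of_nonneg_right hmm1 (by positivity)
    have g3 : 2 * H * ‖u x‖ ≤ 2 * H * q x := mul_le_mul_of_nonneg_left hun (by positivity)
    nlinarith
  have f4 : 4 * Z x ≤ 24 + 2 * M + 2 * H := by
    have : (4 * Z x) * q x ≤ (24 + 2 * M + 2 * H) * q x := by
      simp only [Z]; linarith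
    exact le_of_mul_le_mul_right this (by linarith)
  linarith

section basic2
variable {V : Type*} [NormedAddCommGroup V] [NormedSpace ℝ V]

lemma pd_neg (w : E2 → V) (k : Fin 2) : pd k (fun x => - w x) = fun x => - pd k w x := by
  funext x
  simp [pd, fderiv_fun_neg]

lemma pd_sub {f g : E2 → V}
    (hf : Differentiable ℝ f) (hg : Differentiable ℝ g) (i : Fin 2) :
    pd i (fun x => f x - g x) = fun x => pd i f x - pd i g x := by
  funext x
  simp only [pd, fderiv_fun_sub (hf x) (hg x)]
  simp

lemma e2_decomp (x : E2) : x = x 0 • e2basis 0 + x 1 • e2basis 1 := by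
  ext i; fin_cases i <;> simp [e2basis]

lemma abs_coord_le (x : E2) (i : Fin 2) : |x i| ≤ ‖x‖ := by
  simpa using PiLp.norm_apply_le x i

lemma clm_decomp (A : E2 →L[ℝ] V) :
    A = (EuclideanSpace.proj 0 : E2 →L[ℝ] ℝ).smulRight (A (e2basis 0))
      + (EuclideanSpace.proj 1 : E2 →L[ℝ] ℝ).smulRight (A (e2basis 1)) := by
  ext x
  conv_lhs => rw [e2_decomp x]
  simp

lemma norm_clm_le (A : E2 →L[ℝ] V) : ‖A‖ ≤ ‖A (e2basis 0)‖ + ‖A (e2basis 1)‖ := by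
  apply ContinuousLinearMap.opNorm_le_bound _ (by positivity)
  intro x
  conv_lhs => rw [e2_decomp x]
  rw [map_add, map_smul, map_smul]
  refine (norm_add_le _ _).trans ?_
  rw [norm_smul, norm_smul, Real.norm_eq_abs, Real.norm_eq_abs]
  have := mul_le_mul_of_nonneg_right (abs_coord_le x 0) (norm_nonneg (A (e2basis 0)))
  have := mul_le_mul_of_nonneg_right (abs_coord_le x 1) (norm_nonneg (A (e2basis 1)))
  linarith

lemma contDiff_of_pd {u : E2 → V} {n : ℕ} (hd : Differentiable ℝ u)
    (h : ∀ i, ContDiff ℝ n (pd i u)) : ContDiff ℝ (n + 1 : ℕ) u := by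
  push_cast
  rw [contDiff_succ_iff_fderiv]
  refine ⟨hd, by simp, ?_⟩
  have : fderiv ℝ u = fun x => (EuclideanSpace.proj 0 : E2 →L[ℝ] ℝ).smulRight (pd 0 u x)
      + (EuclideanSpace.proj 1 : E2 →L[ℝ] ℝ).smulRight (pd 1 u x) := by
    funext x; exact clm_decomp _
  rw [this]
  exact (contDiff_const.smulRight (h 0)).add (contDiff_const.smulRight (h 1))

lemma pd_pd_eq {u : E2 → V} (hu : ContDiff ℝ 2 u) (i j : Fin 2) (x : E2) :
    pd i (pd j u) x = fderiv ℝ (fderiv ℝ u) x (e2basis i) (e2basis j) := by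
  have hd : DifferentiableAt ℝ (fderiv ℝ u) x :=
    ((hu.fderiv_right (m := 1) (by norm_num)).differentiable (by norm_num)) x
  rw [show pd i (pd j u) x = fderiv ℝ (pd j u) x (e2basis i) from rfl]
  rw [show pd j u = fun x => (fderiv ℝ u x) ((fun _ => e2basis j) x) from rfl,
    fderiv_clm_apply hd (by fun_prop)]
  simp

lemma pd_comm {u : E2 → V} (hu : ContDiff ℝ 2 u) (i j : Fin 2) :
    pd i (pd j u) = pd j (pd i u) := by
  funext x
  rw [pd_pd_eq hu, pd_pd_eq hu]
  have : IsSymmSndFDerivAt ℝ u x := hu.contDiffAt.isSymmSndFDerivAt (by simp)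
  exact this _ _

lemma pd_lapV {u : E2 → V} (hu : ContDiff ℝ 3 u) (i : Fin 2) :
    pd i (lapV u) = lapV (pd i u) := by
  have h2 : ContDiff ℝ 2 u := hu.of_le (by norm_num)
  have h2' : ∀ k, ContDiff ℝ 2 (pd k u) := fun k => pd_contDiff k hu (by norm_num)
  have h1 : ∀ k, Differentiable ℝ (pd k (pd k u)) := fun k =>
    (pd_contDiff (m := 1) k (h2' k) (by norm_num)).differentiable (by norm_num)
  have e : lapV u = fun x => pd 0 (pd 0 u) x + pd 1 (pd 1 u) x := by
    funext x; simp [lapV, Fin.sum_univ_two]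
  rw [e, pd_add (h1 0) (h1 1)]
  funext x
  simp only [lapV, Fin.sum_univ_two]
  rw [pd_comm (h2' 0) i 0, pd_comm h2 i 0, pd_comm (h2' 1) i 1, pd_comm h2 i 1]

lemma lapV_contDiff {u : E2 → V} {n m : WithTop ℕ∞} (hu : ContDiff ℝ n u) (h : m + 1 + 1 ≤ n) : ContDiff ℝ m (lapV u) := by
  have e : lapV u = fun x => pd 0 (pd 0 u) x + pd 1 (pd 1 u) x := by
    funext x; simp [lapV, Fin.sum_univ_two]
  rw [e]
  exact (pd_contDiff 0 (pd_contDiff 0 hu h) le_rfl).add (pd_contDiff 1 (pd_contDiff 1 hu h) le_rfl)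

lemma pd_hasCompactSupport {u : E2 → V} (h : HasCompactSupport u) (i : Fin 2) :
    HasCompactSupport (pd i u) := h.fderiv_apply ℝ (e2basis i)

lemma lapV_hasCompactSupport {u : E2 → V} (h : HasCompactSupport u) :
    HasCompactSupport (lapV u) := by
  have e : lapV u = pd 0 (pd 0 u) + pd 1 (pd 1 u) := by
    funext x; simp [lapV, Fin.sum_univ_two]
  rw [e]
  exact (pd_hasCompactSupport (pd_hasCompactSupport h 0) 0).add (pd_hasCompactSupport (pd_hasCompactSupport h 1) 1)

end basic2

lemma integrable_mul_test {f χ : E2 → ℝ} (hf : Continuous f) (hχ : Continuous χ) (hc : HasCompactSupport χ) :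
    Integrable (fun x => f x * χ x) :=
  (hf.mul hχ).integrable_of_hasCompactSupport hc.mul_left

lemma ibp {f χ : E2 → ℝ} (hf : Differentiable ℝ f) (hχ : ContDiff ℝ 1 χ) (hc : HasCompactSupport χ) (i : Fin 2)
    (hi : Integrable (fun x => pd i f x * χ x)) :
    ∫ x, f x * pd i χ x = - ∫ x, pd i f x * χ x := by
  have hp : Continuous (pd i χ) := (pd_contDiff (m := 0) i hχ (by norm_num)).continuous
  exact integral_mul_fderiv_eq_neg_fderiv_mul_of_integrable hi
    (integrable_mul_test hf.continuous hp (pd_hasCompactSupport hc i))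
    (integrable_mul_test hf.continuous hχ.continuous hc)
    (fun x _ => hf x) (fun x _ => hχ.differentiable (by norm_num) x)

/-- `Δ u = g` in the sense of distributions. -/
def WeakLap (u g : E2 → ℝ) : Prop :=
  ∀ χ : E2 → ℝ, ContDiff ℝ (⊤ : ℕ∞) χ → HasCompactSupport χ →
    ∫ x, u x * lapV χ x = ∫ x, g x * χ x

lemma WeakLap.pd {u g : E2 → ℝ} (h : WeakLap u g) (hu : ContDiff ℝ 1 u) (hg : ContDiff ℝ 1 g) (i : Fin 2) :
    WeakLap (pd i u) (pd i g) := by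
  intro χ hχ hc
  have hud := hu.differentiable (by norm_num)
  have hgd := hg.differentiable (by norm_num)
  have hpu : Continuous (_root_.pd i u) := (pd_contDiff (m := 0) i hu (by norm_num)).continuous
  have hpg : Continuous (_root_.pd i g) := (pd_contDiff (m := 0) i hg (by norm_num)).continuous
  have hl : ContDiff ℝ (⊤ : ℕ∞) (lapV χ) := lapV_contDiff hχ (by simp)
  have h1 := ibp hud (hl.of_le (by simp)) (lapV_hasCompactSupport hc) i
    (integrable_mul_test hpu hl.continuous (lapV_hasCompactSupport hc))
  have h2 := ibp hgd (hχ.of_le (by simp)) hc i (integrable_mul_test hpg hχ.continuous hc)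
  have h3 := h (_root_.pd i χ) (pd_contDiff i hχ (by simp)) (pd_hasCompactSupport hc i)
  rw [pd_lapV (contDiff_infty.1 hχ 3)] at h1
  linarith

lemma pd_reflect {V : Type*} [NormedAddCommGroup V] [NormedSpace ℝ V] {k : E2 → V} (hk : Differentiable ℝ k)
    (x : E2) (i : Fin 2) :
    pd i (fun t => k (x - t)) = fun t => - pd i k (x - t) := by
  funext t
  have h1 : HasFDerivAt (fun t : E2 => x - t) (-(ContinuousLinearMap.id ℝ E2)) t :=
    (hasFDerivAt_id t).const_sub x
  have := ((hk (x - t)).hasFDerivAt.comp t h1).fderiv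
  simp only [pd]
  rw [show (fun t => k (x - t)) = k ∘ (fun t => x - t) from rfl, this]
  simp

lemma lapV_reflect {k : E2 → ℝ} (hk : ContDiff ℝ 2 k) (x : E2) :
    lapV (fun t => k (x - t)) = fun t => lapV k (x - t) := by
  have hd : Differentiable ℝ k := hk.differentiable (by norm_num)
  have hd' : ∀ i, Differentiable ℝ (pd i k) := fun i =>
    (pd_contDiff (m := 1) i hk (by norm_num)).differentiable (by norm_num)
  have e : ∀ i, pd i (fun t => - pd i k (x - t)) = fun t => pd i (pd i k) (x - t) := by
    intro i
    have := pd_reflect (k := fun y => - pd i k y) (hd' i).neg x i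
    rw [this]
    funext t
    simp [pd_neg]
  funext t
  simp only [lapV, pd_reflect hd, e]

open scoped Convolution in
lemma pd_conv {u k : E2 → ℝ} (hu : Continuous u) (hk : ContDiff ℝ 1 k) (hc : HasCompactSupport k) (i : Fin 2) :
    pd i (u ⋆[ContinuousLinearMap.mul ℝ ℝ, volume] k) = u ⋆[ContinuousLinearMap.mul ℝ ℝ, volume] (pd i k) := by
  funext x
  have h := hc.hasFDerivAt_convolution_right (ContinuousLinearMap.mul ℝ ℝ) (hu.locallyIntegrable (μ := volume)) hk x
  rw [pd, h.fderiv, convolution_precompR_apply]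
  · rfl
  · exact hu.locallyIntegrable
  · exact hc.fderiv ℝ
  · exact hk.continuous_fderiv (by norm_num)

open scoped Convolution in
lemma lapV_conv {u g k : E2 → ℝ} (hu : Continuous u) (h : WeakLap u g) (hk : ContDiff ℝ (⊤ : ℕ∞) k)
    (hc : HasCompactSupport k) :
    lapV (u ⋆[ContinuousLinearMap.mul ℝ ℝ, volume] k) = g ⋆[ContinuousLinearMap.mul ℝ ℝ, volume] k := by
  funext x
  have hk2 : ContDiff ℝ 2 k := contDiff_infty.1 hk 2
  have hpk : ∀ i, ContDiff ℝ (⊤ : ℕ∞) (pd i k) := fun i => pd_contDiff i hk (by simp)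
  have e : ∀ i, pd i (pd i (u ⋆[ContinuousLinearMap.mul ℝ ℝ, volume] k)) x = ∫ t, u t * pd i (pd i k) (x - t) := by
    intro i
    rw [pd_conv hu (hk.of_le (by simp)) hc, pd_conv hu ((hpk i).of_le (by simp)) (pd_hasCompactSupport hc i)]
    rfl
  have hrc : HasCompactSupport (fun t => k (x - t)) := hc.comp_homeomorph (Homeomorph.subLeft x)
  have h_intg : ∀ i, Integrable (fun t => u t * pd i (pd i k) (x - t)) := by
    intro i
    refine integrable_mul_test (χ := fun t => pd i (pd i k) (x - t)) hu ?_ ?_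
    · have := (pd_contDiff (m := (⊤ : ℕ∞)) i (hpk i) (by simp)).continuous
      fun_prop
    · exact (pd_hasCompactSupport (pd_hasCompactSupport hc i) i).comp_homeomorph (Homeomorph.subLeft x)
  have h1 := h (fun t => k (x - t)) (hk.comp (contDiff_const.sub contDiff_id)) hrc
  rw [lapV_reflect hk2] at h1
  have : (g ⋆[ContinuousLinearMap.mul ℝ ℝ, volume] k) x = ∫ t, g t * k (x - t) := rfl
  rw [this, ← h1]
  simp only [lapV, Fin.sum_univ_two, e]
  rw [← integral_add (h_intg 0) (h_intg 1)]
  congr 1; funext t; ring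

/-- standard mollifying bumps -/
def moll (n : ℕ) : ContDiffBump (0 : E2) where
  rIn := 1 / (2 * ((n : ℝ) + 1))
  rOut := 1 / ((n : ℝ) + 1)
  rIn_pos := by positivity
  rIn_lt_rOut := by
    apply one_div_lt_one_div_of_lt (by positivity)
    have : (0 : ℝ) ≤ n := n.cast_nonneg
    linarith

/-- mollification -/
def mollify (u : E2 → ℝ) (n : ℕ) : E2 → ℝ :=
  convolution u ((moll n).normed volume) (ContinuousLinearMap.mul ℝ ℝ) volume

lemma mollify_contDiff {u : E2 → ℝ} (hu : Continuous u) (n : ℕ) : ContDiff ℝ (⊤ : ℕ∞) (mollify u n) :=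
  (moll n).hasCompactSupport_normed.contDiff_convolution_right _ hu.locallyIntegrable
    (moll n).contDiff_normed

lemma mollify_dist {u : E2 → ℝ} (hu : Continuous u) (R ε : ℝ) (hε : 0 < ε) :
    ∃ N, ∀ n ≥ N, ∀ x ∈ Metric.closedBall (0 : E2) R, |mollify u n x - u x| ≤ ε := by
  have huc : UniformContinuousOn u (Metric.closedBall (0 : E2) (R + 1)) :=
    (isCompact_closedBall _ _).uniformContinuousOn_of_continuous hu.continuousOn
  rw [Metric.uniformContinuousOn_iff] at huc
  obtain ⟨δ, hδ, h⟩ := huc ε hε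
  obtain ⟨N, hN⟩ := exists_nat_one_div_lt hδ
  refine ⟨N, fun n hn x hx => ?_⟩
  have hr : (moll n).rOut < δ ∧ (moll n).rOut ≤ 1 := by
    have hnN : (N : ℝ) ≤ n := by exact_mod_cast hn
    have hN0 : (0 : ℝ) ≤ N := N.cast_nonneg
    constructor
    · refine lt_of_le_of_lt ?_ hN
      exact one_div_le_one_div_of_le (by positivity) (by linarith)
    · simp only [moll]
      rw [div_le_one (by positivity)]; linarith
  have e : mollify u n x = (convolution ((moll n).normed volume) u (ContinuousLinearMap.lsmul ℝ ℝ) volume) x := by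
    rw [mollify, ← convolution_flip]
    congr 1
    ext; simp
  rw [e, ← Real.dist_eq]
  rw [mem_closedBall_zero_iff] at hx
  apply ContDiffBump.dist_normed_convolution_le
  · exact hu.aestronglyMeasurable
  · intro y hy
    rw [Metric.mem_ball, dist_eq_norm] at hy
    have : ‖y‖ ≤ ‖x‖ + ‖y - x‖ := by
      have := norm_add_le x (y - x); simpa using this
    apply (h y _ x _ _).le
    · rw [mem_closedBall_zero_iff]; linarith [hr.2]
    · rw [mem_closedBall_zero_iff]; linarith
    · rw [dist_eq_norm]; linarith [hr.1]

lemma base_regularity {u g : E2 → ℝ} (hu : Continuous u) (hg : Continuous g) (h : WeakLap u g) :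
    ContDiff ℝ 1 u := by
  have hsm := mollify_contDiff hu
  have hdf : ∀ n, Differentiable ℝ (mollify u n) := fun n => (hsm n).differentiable (by simp)
  have hlap : ∀ n, lapV (mollify u n) = mollify g n := fun n =>
    lapV_conv hu h (moll n).contDiff_normed (moll n).hasCompactSupport_normed
  have hcau : ∀ R ε : ℝ, 0 < ε → ∃ N, ∀ n ≥ N, ∀ m ≥ N, ∀ x ∈ Metric.closedBall (0 : E2) R,
      dist (fderiv ℝ (mollify u m) x) (fderiv ℝ (mollify u n) x) ≤ ε := by
    intro R ε hε
    obtain ⟨N1, h1⟩ := mollify_dist hu (R + 2) (ε / 16) (by positivity)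
    obtain ⟨N2, h2⟩ := mollify_dist hg (R + 2) (ε / 16) (by positivity)
    refine ⟨max N1 N2, fun n hn m hm x hx => ?_⟩
    have hsub : ∀ y ∈ Metric.closedBall x 2, y ∈ Metric.closedBall (0:E2) (R + 2) := by
      intro y hy
      rw [mem_closedBall_zero_iff] at hx ⊢
      rw [mem_closedBall_iff_norm] at hy
      have := norm_add_le x (y - x)
      simp at this; linarith
    have hpd : ∀ k, pd k (fun y => mollify u m y - mollify u n y) = fun y => pd k (mollify u m) y - pd k (mollify u n) y := by
      intro k
      rw [pd_sub (hdf m) (hdf n)]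
    have hpd2 : ∀ k n, Differentiable ℝ (pd k (mollify u n)) := fun k n =>
      (pd_contDiff (m := (⊤ : ℕ∞)) k (hsm n) (by simp)).differentiable (by simp)
    have hl : ∀ y, lapV (fun y => mollify u m y - mollify u n y) y = mollify g m y - mollify g n y := by
      intro y
      rw [← hlap, ← hlap]
      simp only [lapV, Fin.sum_univ_two, hpd, pd_sub (hpd2 _ m) (hpd2 _ n)]
      ring
    have key : ∀ i, |pd i (fun y => mollify u m y - mollify u n y) x| ≤ 2 * (ε / 8) + ε / 8 := by
      intro i
      apply grad_est _ x _ _ (by positivity)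
      · intro y hy
        have a1 := abs_le.1 (h1 n (le_trans (le_max_left _ _) hn) y (hsub y hy))
        have a2 := abs_le.1 (h1 m (le_trans (le_max_left _ _) hm) y (hsub y hy))
        rw [abs_le]; constructor <;> linarith [a1.1, a1.2, a2.1, a2.2]
      · intro y hy
        rw [hl]
        have a1 := abs_le.1 (h2 n (le_trans (le_max_right _ _) hn) y (hsub y hy))
        have a2 := abs_le.1 (h2 m (le_trans (le_max_right _ _) hm) y (hsub y hy))
        rw [abs_le]; constructor <;> linarith [a1.1, a1.2, a2.1, a2.2]
      · exact contDiff_infty.1 ((hsm m).sub (hsm n)) 2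
    rw [dist_eq_norm]
    refine (norm_clm_le _).trans ?_
    have k0 := key 0
    have k1 := key 1
    rw [hpd] at k0 k1
    have e : ∀ i, ‖(fderiv ℝ (mollify u m) x - fderiv ℝ (mollify u n) x) (e2basis i)‖
        = |pd i (mollify u m) x - pd i (mollify u n) x| := by
      intro i; simp [pd]
    rw [e, e]; linarith
  have hlim : ∀ x, ∃ A : E2 →L[ℝ] ℝ, Tendsto (fun n => fderiv ℝ (mollify u n) x) atTop (𝓝 A) := by
    intro x
    apply cauchySeq_tendsto_of_complete
    rw [Metric.cauchySeq_iff]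
    intro ε hε
    obtain ⟨N, hN⟩ := hcau ‖x‖ (ε / 2) (by positivity)
    exact ⟨N, fun m hm n hn => lt_of_le_of_lt (hN n hn m hm x (by simp)) (by linarith)⟩
  choose G hG using hlim
  have hloc : TendstoLocallyUniformly (fun n => fderiv ℝ (mollify u n)) G atTop := by
    rw [Metric.tendstoLocallyUniformly_iff]
    intro ε hε x
    refine ⟨Metric.closedBall 0 (‖x‖ + 1), ?_, ?_⟩
    · apply Filter.mem_of_superset (Metric.ball_mem_nhds x one_pos)
      intro y hy
      rw [mem_closedBall_zero_iff]
      rw [mem_ball_iff_norm] at hy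
      have := norm_add_le x (y - x)
      simp at this; linarith
    · obtain ⟨N, hN⟩ := hcau (‖x‖ + 1) (ε / 2) (by positivity)
      filter_upwards [eventually_ge_atTop N] with n hn y hy
      have h3 : Tendsto (fun m => dist (fderiv ℝ (mollify u m) y) (fderiv ℝ (mollify u n) y)) atTop
          (𝓝 (dist (G y) (fderiv ℝ (mollify u n) y))) := (hG y).dist tendsto_const_nhds
      have h4 : dist (G y) (fderiv ℝ (mollify u n) y) ≤ ε / 2 :=
        le_of_tendsto h3 ((eventually_ge_atTop N).mono fun m hm => hN n hn m hm y hy)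
      linarith
  have hder : ∀ x, HasFDerivAt u (G x) x := by
    intro x
    refine hasFDerivAt_of_tendstoLocallyUniformlyOn (𝕜 := ℝ) (l := atTop) (f := fun n => mollify u n) (isOpen_univ)
      (tendstoLocallyUniformlyOn_univ.2 hloc) (fun n y _ => (hdf n y).hasFDerivAt) ?_ (mem_univ x)
    intro y _
    rw [Metric.tendsto_atTop]
    intro ε hε
    obtain ⟨N, hN⟩ := mollify_dist hu ‖y‖ (ε / 2) (by positivity)
    refine ⟨N, fun n hn => lt_of_le_of_lt ?_ (by linarith : ε / 2 < ε)⟩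
    rw [Real.dist_eq]; exact hN n hn y (by simp)
  have hGc : Continuous G := hloc.continuous
    (Frequently.of_forall fun n => (hsm n).continuous_fderiv (by simp))
  rw [contDiff_one_iff_fderiv]
  refine ⟨fun x => (hder x).differentiableAt, ?_⟩
  rwa [show fderiv ℝ u = G from funext fun x => (hder x).fderiv]

lemma regularity (n : ℕ) : ∀ {u g : E2 → ℝ}, Continuous u → ContDiff ℝ n g → WeakLap u g →
    ContDiff ℝ (n + 1 : ℕ) u := by
  induction n with
  | zero =>
    intro u g hu hg h
    simpa using base_regularity hu hg.continuous h
  | succ n ih =>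
    intro u g hu hg h
    have h1 := base_regularity hu hg.continuous h
    have hg1 : ContDiff ℝ 1 g := hg.of_le (by push_cast; simp)
    apply contDiff_of_pd (h1.differentiable (by norm_num))
    intro i
    refine ih (g := pd i g) ?_ ?_ (h.pd h1 hg1 i)
    · exact (pd_contDiff (m := 0) i h1 (by norm_num)).continuous
    · exact pd_contDiff i hg (by push_cast; exact le_rfl)

lemma WeakLap.eq {u g : E2 → ℝ} (hu : ContDiff ℝ 2 u) (hg : Continuous g) (h : WeakLap u g) : lapV u = g := by
  have hl : Continuous (lapV u) := (lapV_contDiff (m := 0) hu (by norm_num)).continuous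
  have hae : lapV u =ᵐ[volume] g := by
    apply ae_eq_of_integral_contDiff_smul_eq hl.locallyIntegrable hg.locallyIntegrable
    intro χ hχ hc
    have hχ1 : ContDiff ℝ 1 χ := hχ.of_le (by simp)
    have hd := hu.differentiable (by norm_num)
    have hp : ∀ i, ContDiff ℝ 1 (_root_.pd i u) := fun i => pd_contDiff i hu (by norm_num)
    have hpχ : ∀ i, ContDiff ℝ (⊤ : ℕ∞) (_root_.pd i χ) := fun i => pd_contDiff i hχ (by simp)
    have hppχ : ∀ i, ContDiff ℝ (⊤ : ℕ∞) (_root_.pd i (_root_.pd i χ)) := fun i => pd_contDiff i (hpχ i) (by simp)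
    have hppu : ∀ i, Continuous (_root_.pd i (_root_.pd i u)) := fun i =>
      (pd_contDiff (m := 0) i (hp i) (by norm_num)).continuous
    have i1 : ∀ i, ∫ x, u x * _root_.pd i (_root_.pd i χ) x = ∫ x, _root_.pd i (_root_.pd i u) x * χ x := by
      intro i
      have a1 := ibp hd ((hpχ i).of_le (by simp)) (pd_hasCompactSupport hc i) i
        (integrable_mul_test (hp i).continuous (hpχ i).continuous (pd_hasCompactSupport hc i))
      have a2 := ibp ((hp i).differentiable (by norm_num)) hχ1 hc i
        (integrable_mul_test (hppu i) hχ.continuous hc)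
      linarith
    have i2 := h χ hχ hc
    have i3 : ∫ x, u x * lapV χ x = ∫ x, lapV u x * χ x := by
      simp only [lapV, Fin.sum_univ_two, mul_add, add_mul]
      rw [integral_add, integral_add, i1, i1]
      · exact integrable_mul_test (hppu 0) hχ.continuous hc
      · exact integrable_mul_test (hppu 1) hχ.continuous hc
      · exact integrable_mul_test hu.continuous (hppχ 0).continuous (pd_hasCompactSupport (pd_hasCompactSupport hc 0) 0)
      · exact integrable_mul_test hu.continuous (hppχ 1).continuous (pd_hasCompactSupport (pd_hasCompactSupport hc 1) 1)
    simp only [smul_eq_mul, mul_comm (χ _)]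
    rw [← i3, i2]
  exact (Continuous.ae_eq_iff_eq volume hl hg).1 hae

section LBsec
variable {V W : Type*} [NormedAddCommGroup V] [NormedSpace ℝ V] [NormedAddCommGroup W] [NormedSpace ℝ W]

/-- locally uniformly bounded sequences -/
def LB (F : ℕ → E2 → V) : Prop :=
  ∀ R : ℝ, ∃ C : ℝ, ∀ n, ∀ x ∈ Metric.closedBall (0 : E2) R, ‖F n x‖ ≤ C

/-- locally uniformly bounded sequences, with partial derivatives up to order `k` -/
def LBk : ℕ → (ℕ → E2 → V) → Prop
  | 0, F => LB F
  | k + 1, F => LB F ∧ ∀ i, LBk k (fun n => pd i (F n))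

lemma LBk.lb {k : ℕ} {F : ℕ → E2 → V} (h : LBk k F) : LB F := by
  cases k with
  | zero => exact h
  | succ k => exact h.1

lemma LBk.pred {k : ℕ} : ∀ {F : ℕ → E2 → V}, LBk (k + 1) F → LBk k F := by
  induction k with
  | zero => intro F h; exact h.1
  | succ k ih => intro F h; exact ⟨h.1, fun i => ih (h.2 i)⟩

lemma LB.add {F G : ℕ → E2 → V} (hF : LB F) (hG : LB G) : LB (fun n x => F n x + G n x) := by
  intro R
  obtain ⟨C, hC⟩ := hF R
  obtain ⟨D, hD⟩ := hG R
  exact ⟨C + D, fun n x hx => (norm_add_le _ _).trans (add_le_add (hC n x hx) (hD n x hx))⟩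

lemma LB.mul {F G : ℕ → E2 → ℝ} (hF : LB F) (hG : LB G) : LB (fun n x => F n x * G n x) := by
  intro R
  obtain ⟨C, hC⟩ := hF R
  obtain ⟨D, hD⟩ := hG R
  refine ⟨C * D, fun n x hx => ?_⟩
  rw [norm_mul]
  exact mul_le_mul (hC n x hx) (hD n x hx) (norm_nonneg _) ((norm_nonneg _).trans (hC n x hx))

lemma LB.clm {F : ℕ → E2 → V} (hF : LB F) (A : V →L[ℝ] W) : LB (fun n x => A (F n x)) := by
  intro R
  obtain ⟨C, hC⟩ := hF R
  exact ⟨‖A‖ * C, fun n x hx => (A.le_opNorm _).trans (mul_le_mul_of_nonneg_left (hC n x hx) (norm_nonneg _))⟩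

lemma pd_smooth {u : E2 → V} (i : Fin 2) (hu : ContDiff ℝ (⊤ : ℕ∞) u) : ContDiff ℝ (⊤ : ℕ∞) (pd i u) :=
  pd_contDiff i hu (by simp)

lemma smooth_diff {u : E2 → V} (hu : ContDiff ℝ (⊤ : ℕ∞) u) : Differentiable ℝ u :=
  hu.differentiable (by simp)

lemma LBk.add {k : ℕ} : ∀ {F G : ℕ → E2 → V}, (∀ n, ContDiff ℝ (⊤ : ℕ∞) (F n)) →
    (∀ n, ContDiff ℝ (⊤ : ℕ∞) (G n)) → LBk k F → LBk k G → LBk k (fun n x => F n x + G n x) := by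
  induction k with
  | zero => intro F G _ _ hF hG; exact LB.add hF hG
  | succ k ih =>
    intro F G sF sG hF hG
    refine ⟨LB.add hF.1 hG.1, fun i => ?_⟩
    simp only [pd_add (smooth_diff (sF _)) (smooth_diff (sG _))]
    exact ih (fun n => pd_smooth i (sF n)) (fun n => pd_smooth i (sG n)) (hF.2 i) (hG.2 i)

lemma LBk.mul {k : ℕ} : ∀ {F G : ℕ → E2 → ℝ}, (∀ n, ContDiff ℝ (⊤ : ℕ∞) (F n)) →
    (∀ n, ContDiff ℝ (⊤ : ℕ∞) (G n)) → LBk k F → LBk k G → LBk k (fun n x => F n x * G n x) := by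
  induction k with
  | zero => intro F G _ _ hF hG; exact LB.mul hF hG
  | succ k ih =>
    intro F G sF sG hF hG
    refine ⟨LB.mul hF.1 hG.1, fun i => ?_⟩
    simp only [pd_mul (smooth_diff (sF _)) (smooth_diff (sG _))]
    exact LBk.add (fun n => (sF n).mul (pd_smooth i (sG n))) (fun n => (pd_smooth i (sF n)).mul (sG n))
      (ih sF (fun n => pd_smooth i (sG n)) hF.pred (hG.2 i))
      (ih (fun n => pd_smooth i (sF n)) sG (hF.2 i) hG.pred)

lemma LBk.clm {k : ℕ} (A : V →L[ℝ] W) : ∀ {F : ℕ → E2 → V}, (∀ n, ContDiff ℝ (⊤ : ℕ∞) (F n)) →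
    LBk k F → LBk k (fun n x => A (F n x)) := by
  induction k with
  | zero => intro F _ hF; exact LB.clm hF A
  | succ k ih =>
    intro F sF hF
    refine ⟨LB.clm hF.1 A, fun i => ?_⟩
    have : ∀ n, pd i (fun x => A (F n x)) = fun x => A (pd i (F n) x) := by
      intro n; funext x
      have := (A.hasFDerivAt.comp x (smooth_diff (sF n) x).hasFDerivAt).fderiv
      simp only [pd]
      rw [show (fun x => A (F n x)) = A ∘ F n from rfl, this]; rfl
    simp only [this]
    exact ih (fun n => pd_smooth i (sF n)) (hF.2 i)

lemma LBk.fderiv {k : ℕ} : ∀ {F : ℕ → E2 → V}, (∀ n, ContDiff ℝ (⊤ : ℕ∞) (F n)) →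
    LBk (k + 1) F → LBk k (fun n => fderiv ℝ (F n)) := by
  have base : ∀ {k : ℕ} {F : ℕ → E2 → V}, LBk (k + 1) F → LB (fun n => _root_.fderiv ℝ (F n)) := by
    intro k F h R
    obtain ⟨C, hC⟩ := (h.2 0).lb R
    obtain ⟨D, hD⟩ := (h.2 1).lb R
    exact ⟨C + D, fun n x hx => (norm_clm_le _).trans (add_le_add (hC n x hx) (hD n x hx))⟩
  induction k with
  | zero => intro F _ hF; exact base hF
  | succ k ih =>
    intro F sF hF
    refine ⟨base hF, fun i => ?_⟩
    have : ∀ n, pd i (_root_.fderiv ℝ (F n)) = _root_.fderiv ℝ (pd i (F n)) := by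
      intro n; funext x
      have h2 := contDiff_infty.1 (sF n) 2
      rw [clm_decomp (pd i (_root_.fderiv ℝ (F n)) x), clm_decomp (_root_.fderiv ℝ (pd i (F n)) x)]
      have : ∀ j, pd i (_root_.fderiv ℝ (F n)) x (e2basis j) = _root_.fderiv ℝ (pd i (F n)) x (e2basis j) := by
        intro j
        have e1 := pd_pd_eq h2 i j x
        rw [pd_comm h2] at e1
        exact e1.symm
      rw [this, this]
    simp only [this]
    exact ih (fun n => pd_smooth i (sF n)) (hF.2 i)

lemma LBk.of_lap {k : ℕ} : ∀ {u : ℕ → E2 → ℝ}, (∀ n, ContDiff ℝ (⊤ : ℕ∞) (u n)) → LB u →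
    LBk k (fun n => lapV (u n)) → LBk (k + 1) u := by
  have base : ∀ {u : ℕ → E2 → ℝ}, (∀ n, ContDiff ℝ (⊤ : ℕ∞) (u n)) → LB u →
    LB (fun n => lapV (u n)) → ∀ i, LB (fun n => pd i (u n)) := by
    intro u su hu hl i R
    obtain ⟨C, hC⟩ := hu (R + 2)
    obtain ⟨D, hD⟩ := hl (R + 2)
    refine ⟨2 * C + (|D| + 1), fun n x hx => ?_⟩
    have hsub : ∀ y ∈ Metric.closedBall x 2, y ∈ Metric.closedBall (0:E2) (R + 2) := by
      intro y hy
      rw [mem_closedBall_zero_iff] at hx ⊢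
      rw [mem_closedBall_iff_norm] at hy
      have := norm_add_le x (y - x)
      simp at this; linarith
    apply grad_est (contDiff_infty.1 (su n) 2) x _ _ (by positivity)
    · exact fun y hy => hC n y (hsub y hy)
    · intro y hy
      have := hD n y (hsub y hy)
      rw [Real.norm_eq_abs] at this
      linarith [le_abs_self D]
  induction k with
  | zero => intro u su hu hl; exact ⟨hu, base su hu hl⟩
  | succ k ih =>
    intro u su hu hl
    refine ⟨hu, fun i => ih (fun n => pd_smooth i (su n)) (base su hu hl.lb i) ?_⟩
    have := hl.2 i
    simp only [pd_lapV (contDiff_infty.1 (su _) 3)] at this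
    exact this

lemma arzela {F : ℕ → E2 → V} [ProperSpace V] (h1 : LB F)
    (h2 : ∀ R : ℝ, ∃ L : ℝ, ∀ n, ∀ x ∈ Metric.closedBall (0 : E2) R, ∀ y ∈ Metric.closedBall (0 : E2) R,
      ‖F n x - F n y‖ ≤ L * ‖x - y‖) :
    ∃ φ : ℕ → ℕ, StrictMono φ ∧ ∃ G : E2 → V, TendstoLocallyUniformly (fun n => F (φ n)) G atTop := by
  choose B hB using h1
  choose L hL using h2
  let K : Set (E2 → V) := {G | (∀ x, ‖G x‖ ≤ B ‖x‖) ∧ ∀ R : ℝ, ∀ x ∈ Metric.closedBall (0 : E2) R,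
    ∀ y ∈ Metric.closedBall (0 : E2) R, ‖G x - G y‖ ≤ L R * ‖x - y‖}
  have hFK : ∀ n, F n ∈ K := fun n => ⟨fun x => hB _ n x (by simp), fun R x hx y hy => hL R n x hx y hy⟩
  have hKc : IsCompact K := by
    apply IsCompact.of_isClosed_subset (isCompact_univ_pi (fun x : E2 => isCompact_closedBall (0 : V) (B ‖x‖)))
    · have : K = (⋂ x : E2, {G : E2 → V | ‖G x‖ ≤ B ‖x‖}) ∩ ⋂ (R : ℝ), ⋂ x ∈ Metric.closedBall (0 : E2) R,
          ⋂ y ∈ Metric.closedBall (0 : E2) R, {G : E2 → V | ‖G x - G y‖ ≤ L R * ‖x - y‖} := by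
        ext G; simp [K]
      rw [this]
      refine IsClosed.inter (isClosed_iInter fun x => ?_) (isClosed_iInter fun R => isClosed_biInter fun x _ =>
        isClosed_biInter fun y _ => ?_)
      · exact isClosed_le (by fun_prop) continuous_const
      · exact isClosed_le (by fun_prop) continuous_const
    · intro G hG x _
      rw [mem_closedBall_zero_iff]; exact hG.1 x
  have heq : ∀ x : E2, ∀ ε > 0, ∃ δ > 0, ∀ y, dist x y < δ → ∀ G ∈ K, dist (G x) (G y) < ε := by
    intro x ε hε
    let Λ := |L (‖x‖ + 1)| + 1
    have hΛ : 0 < Λ := by positivity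
    refine ⟨min 1 (ε / Λ), by positivity, fun y hy G hG => ?_⟩
    have hy1 : ‖x - y‖ < 1 := by rw [← dist_eq_norm]; exact hy.trans_le (min_le_left _ _)
    have hy2 : ‖x - y‖ < ε / Λ := by rw [← dist_eq_norm]; exact hy.trans_le (min_le_right _ _)
    have hyn : ‖y‖ ≤ ‖x‖ + 1 := by
      have := norm_sub_le x (x - y)
      simp at this; linarith
    have := hG.2 (‖x‖ + 1) x (by rw [mem_closedBall_zero_iff]; linarith) y (by rw [mem_closedBall_zero_iff]; linarith)
    rw [dist_eq_norm]
    calc _ ≤ L (‖x‖ + 1) * ‖x - y‖ := this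
      _ ≤ Λ * ‖x - y‖ := by
        apply mul_le_mul_of_nonneg_right _ (norm_nonneg _)
        have := le_abs_self (L (‖x‖ + 1)); simp only [Λ]; linarith
      _ < ε := by rwa [lt_div_iff₀' hΛ] at hy2
  have hcont : ∀ G ∈ K, Continuous G := by
    intro G hG
    rw [Metric.continuous_iff]
    intro x ε hε
    obtain ⟨δ, hδ, h⟩ := heq x ε hε
    refine ⟨δ, hδ, fun y hy => ?_⟩
    rw [dist_comm]; exact h y (by rwa [dist_comm]) G hG
  let S : Set C(E2, V) := {G | (⇑G) ∈ K}
  have hS : IsCompact S := by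
    apply ArzelaAscoli.isCompact_of_equicontinuous
    · have : Set.image ContinuousMap.toFun S = K := by
        ext G
        constructor
        · rintro ⟨g, hg, rfl⟩; exact hg
        · intro hG; exact ⟨⟨G, hcont G hG⟩, hG, rfl⟩
      rw [this]; exact hKc
    · intro x
      rw [Metric.equicontinuousAt_iff]
      intro ε hε
      obtain ⟨δ, hδ, h⟩ := heq x ε hε
      exact ⟨δ, hδ, fun y hy G => h y (by rwa [dist_comm]) _ G.2⟩
  obtain ⟨G, _, φ, hφ, hlim⟩ := hS.tendsto_subseq (x := fun n => (⟨F n, hcont _ (hFK n)⟩ : C(E2, V))) (fun n => hFK n)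
  exact ⟨φ, hφ, G, ContinuousMap.tendsto_iff_tendstoLocallyUniformly.1 hlim⟩

lemma LBk.lip {F : ℕ → E2 → V} (sF : ∀ n, ContDiff ℝ (⊤ : ℕ∞) (F n)) (h : LBk 1 F) (R : ℝ) :
    ∃ L : ℝ, ∀ n, ∀ x ∈ Metric.closedBall (0 : E2) R, ∀ y ∈ Metric.closedBall (0 : E2) R,
      ‖F n x - F n y‖ ≤ L * ‖x - y‖ := by
  obtain ⟨C, hC⟩ := (LBk.fderiv sF h).lb R
  refine ⟨C, fun n x hx y hy => ?_⟩
  exact (convex_closedBall (0 : E2) R).norm_image_sub_le_of_norm_fderiv_le (𝕜 := ℝ)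
    (fun z _ => smooth_diff (sF n) z) (fun z hz => hC n z hz) hy hx

end LBsec

lemma c2_compact {F : ℕ → E2 → E2} (sF : ∀ n, ContDiff ℝ (⊤ : ℕ∞) (F n)) (h : LBk 3 F) :
    ∃ φ : ℕ → ℕ, StrictMono φ ∧ ∃ y : E2 → E2, TendstoC2LocSeq (fun n => F (φ n)) y ∧ ContDiff ℝ 2 y := by
  have s1 : ∀ n, ContDiff ℝ (⊤ : ℕ∞) (fderiv ℝ (F n)) := fun n => (sF n).fderiv_right (by simp)
  have s2 : ∀ n, ContDiff ℝ (⊤ : ℕ∞) (fderiv ℝ (fderiv ℝ (F n))) := fun n => (s1 n).fderiv_right (by simp)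
  have h1 : LBk 2 (fun n => fderiv ℝ (F n)) := LBk.fderiv sF h
  have h2 : LBk 1 (fun n => fderiv ℝ (fderiv ℝ (F n))) := LBk.fderiv s1 h1
  let P : ℕ → E2 → E2 × (E2 →L[ℝ] E2) × (E2 →L[ℝ] E2 →L[ℝ] E2) :=
    fun n x => (F n x, fderiv ℝ (F n) x, fderiv ℝ (fderiv ℝ (F n)) x)
  have hP : LB P := by
    intro R
    obtain ⟨C0, hC0⟩ := h.lb R
    obtain ⟨C1, hC1⟩ := h1.lb R
    obtain ⟨C2, hC2⟩ := h2.lb R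
    refine ⟨max C0 (max C1 C2), fun n x hx => ?_⟩
    exact max_le_max (hC0 n x hx) (max_le_max (hC1 n x hx) (hC2 n x hx))
  have hPl : ∀ R : ℝ, ∃ L : ℝ, ∀ n, ∀ x ∈ Metric.closedBall (0 : E2) R, ∀ y ∈ Metric.closedBall (0 : E2) R,
      ‖P n x - P n y‖ ≤ L * ‖x - y‖ := by
    intro R
    obtain ⟨C0, hC0⟩ := LBk.lip sF h.pred.pred R
    obtain ⟨C1, hC1⟩ := LBk.lip s1 h1.pred R
    obtain ⟨C2, hC2⟩ := LBk.lip s2 h2 R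
    refine ⟨max C0 (max C1 C2), fun n x hx y hy => ?_⟩
    have hn := norm_nonneg (x - y)
    refine max_le ?_ (max_le ?_ ?_)
    · exact (hC0 n x hx y hy).trans (mul_le_mul_of_nonneg_right (le_max_left _ _) hn)
    · exact (hC1 n x hx y hy).trans (mul_le_mul_of_nonneg_right ((le_max_left _ _).trans (le_max_right _ _)) hn)
    · exact (hC2 n x hx y hy).trans (mul_le_mul_of_nonneg_right ((le_max_right _ _).trans (le_max_right _ _)) hn)
  obtain ⟨φ, hφ, G, hG⟩ := arzela hP hPl
  have t0 : TendstoLocallyUniformly (fun n => F (φ n)) (fun x => (G x).1) atTop :=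
    uniformContinuous_fst.comp_tendstoLocallyUniformly hG
  have t1 : TendstoLocallyUniformly (fun n => fderiv ℝ (F (φ n))) (fun x => (G x).2.1) atTop :=
    (uniformContinuous_fst.comp uniformContinuous_snd).comp_tendstoLocallyUniformly hG
  have t2 : TendstoLocallyUniformly (fun n => fderiv ℝ (fderiv ℝ (F (φ n)))) (fun x => (G x).2.2) atTop :=
    (uniformContinuous_snd.comp uniformContinuous_snd).comp_tendstoLocallyUniformly hG
  have d0 : ∀ x, HasFDerivAt (fun x => (G x).1) (G x).2.1 x := fun x =>
    hasFDerivAt_of_tendstoLocallyUniformlyOn (𝕜 := ℝ) (l := atTop) isOpen_univ (tendstoLocallyUniformlyOn_univ.2 t1)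
      (fun n y _ => (smooth_diff (sF (φ n)) y).hasFDerivAt)
      (fun y _ => (tendstoLocallyUniformlyOn_univ.2 t0).tendsto_at (mem_univ y)) (mem_univ x)
  have d1 : ∀ x, HasFDerivAt (fun x => (G x).2.1) (G x).2.2 x := fun x =>
    hasFDerivAt_of_tendstoLocallyUniformlyOn (𝕜 := ℝ) (l := atTop) isOpen_univ (tendstoLocallyUniformlyOn_univ.2 t2)
      (fun n y _ => (smooth_diff (s1 (φ n)) y).hasFDerivAt)
      (fun y _ => (tendstoLocallyUniformlyOn_univ.2 t1).tendsto_at (mem_univ y)) (mem_univ x)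
  have e0 : fderiv ℝ (fun x => (G x).1) = fun x => (G x).2.1 := funext fun x => (d0 x).fderiv
  have e1 : fderiv ℝ (fun x => (G x).2.1) = fun x => (G x).2.2 := funext fun x => (d1 x).fderiv
  have c2 : Continuous (fun x => (G x).2.2) := t2.continuous
    (Frequently.of_forall fun n => (s2 (φ n)).continuous)
  refine ⟨φ, hφ, fun x => (G x).1, ⟨t0, ?_, ?_⟩, ?_⟩
  · rw [e0]; exact t1
  · rw [e0, e1]; exact t2
  · have : ContDiff ℝ 1 (fun x => (G x).2.1) := by
      rw [contDiff_one_iff_fderiv, e1]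
      exact ⟨fun x => (d1 x).differentiableAt, c2⟩
    have h2 : ContDiff ℝ (1 + 1) (fun x => (G x).1) := by
      rw [contDiff_succ_iff_fderiv, e0]
      exact ⟨fun x => (d0 x).differentiableAt, by simp, this⟩
    exact h2.of_le (by norm_num)

/-- energy density -/
def dens (ε a : ℝ) (μ : E2 → ℝ) (f : E2 → E2) (u : E2 → E2) (x : E2) : ℝ :=
  (1/2) * gradSq u x - (1/(2*ε^2)) * μ x * ‖u x‖^2
    + (1/(4*ε^2)) * ‖u x‖^4 - (a/ε) * (inner ℝ (f x) (u x) : ℝ)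

/-- perturbation -/
def pert (v : E2 → E2) (χ : E2 → ℝ) (j : Fin 2) (t : ℝ) (x : E2) : E2 := v x + (t * χ x) • e2basis j

/-- first-order coefficient, zeroth order part -/
def zcoef (ε a : ℝ) (μ : E2 → ℝ) (f v : E2 → E2) (j : Fin 2) (x : E2) : ℝ :=
  -(1/ε^2) * μ x * v x j + (1/ε^2) * ‖v x‖^2 * v x j - (a/ε) * f x j

def cP (ε a : ℝ) (μ : E2 → ℝ) (f v : E2 → E2) (χ : E2 → ℝ) (j : Fin 2) (x : E2) : ℝ :=
  (∑ i, pd i (fun y => v y j) x * pd i χ x) + zcoef ε a μ f v j x * χ x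
def cQ (ε : ℝ) (μ : E2 → ℝ) (v : E2 → E2) (χ : E2 → ℝ) (j : Fin 2) (x : E2) : ℝ :=
  (1/2) * (∑ i, pd i χ x ^ 2) + (1/(4*ε^2)) * (-2 * μ x + 4 * (v x j)^2 + 2 * ‖v x‖^2) * χ x ^ 2
def cS (ε : ℝ) (v : E2 → E2) (χ : E2 → ℝ) (j : Fin 2) (x : E2) : ℝ :=
  (1/ε^2) * v x j * χ x ^ 3
def cT (ε : ℝ) (χ : E2 → ℝ) (x : E2) : ℝ :=
  (1/(4*ε^2)) * χ x ^ 4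

lemma inner_e2basis (x : E2) (j : Fin 2) : (inner ℝ x (e2basis j) : ℝ) = x j := by
  simp [e2basis, EuclideanSpace.inner_single_right]

lemma norm_add_basis (x : E2) (j : Fin 2) (r : ℝ) :
    ‖x + r • e2basis j‖^2 = ‖x‖^2 + 2 * r * x j + r^2 := by
  rw [norm_add_sq_real, inner_smul_right, inner_e2basis, norm_smul, norm_e2basis]
  simp; ring

lemma pd_comp {v : E2 → E2} (hv : Differentiable ℝ v) (i j : Fin 2) (x : E2) :
    pd i (fun y => v y j) x = (pd i v x) j := by
  have h := ((EuclideanSpace.proj j : E2 →L[ℝ] ℝ).hasFDerivAt (x := v x)).comp x (hv x).hasFDerivAt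
  have h2 : HasFDerivAt (fun y => v y j) ((EuclideanSpace.proj j : E2 →L[ℝ] ℝ).comp (fderiv ℝ v x)) x := h
  simp only [pd, h2.fderiv]
  rfl

lemma pert_fderiv {v : E2 → E2} {χ : E2 → ℝ} (hv : Differentiable ℝ v) (hχ : Differentiable ℝ χ) (j : Fin 2)
    (t : ℝ) (x : E2) : HasFDerivAt (pert v χ j t)
      (fderiv ℝ v x + (t • fderiv ℝ χ x).smulRight (e2basis j)) x := by
  have h1 : HasFDerivAt (fun x => t * χ x) (t • fderiv ℝ χ x) x := (hχ x).hasFDerivAt.const_mul t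
  exact (hv x).hasFDerivAt.add (h1.smul_const (e2basis j))

lemma pert_pd {v : E2 → E2} {χ : E2 → ℝ} (hv : Differentiable ℝ v) (hχ : Differentiable ℝ χ) (j : Fin 2)
    (t : ℝ) (x : E2) (i : Fin 2) : fderiv ℝ (pert v χ j t) x (e2basis i) =
      pd i v x + (t * pd i χ x) • e2basis j := by
  rw [(pert_fderiv hv hχ j t x).fderiv]
  simp [pd]

lemma dens_pert {ε a : ℝ} (hε : ε ≠ 0) {μ : E2 → ℝ} {f v : E2 → E2} {χ : E2 → ℝ}
    (hv : Differentiable ℝ v) (hχ : Differentiable ℝ χ) (j : Fin 2) (t : ℝ) (x : E2) :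
    dens ε a μ f (pert v χ j t) x = dens ε a μ f v x + (t * cP ε a μ f v χ j x + t^2 * cQ ε μ v χ j x
      + t^3 * cS ε v χ j x + t^4 * cT ε χ x) := by
  have e4 : ∀ z : E2, ‖z‖^4 = (‖z‖^2)^2 := fun z => by ring
  simp only [dens, gradSq, pert_pd hv hχ, Fin.sum_univ_two, norm_add_basis, cP, cQ, cS, cT, zcoef, pd_comp hv]
  simp only [e4]
  simp only [pert, norm_add_basis, inner_add_right, inner_smul_right, inner_e2basis]
  simp only [pd]
  field_simp
  ring

lemma memLp_add_aux {F : Type*} [NormedAddCommGroup F] {p q : E2 → F} (hp : MemLp p 2 (volume : Measure E2))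
    (hq : MemLp q 2 (volume : Measure E2)) : MemLp (p + q) 2 (volume : Measure E2) := hp.add hq

lemma pert_memH1 {v : E2 → E2} {χ : E2 → ℝ} (hv : MemH1 v) (hχ : ContDiff ℝ 1 χ) (hc : HasCompactSupport χ)
    (j : Fin 2) (t : ℝ) : MemH1 (pert v χ j t) := by
  obtain ⟨h1, h2, h3⟩ := hv
  have hd : Differentiable ℝ χ := hχ.differentiable (by simp)
  refine ⟨fun x => (pert_fderiv h1 hd j t x).differentiableAt, ?_, ?_⟩
  · have : MemLp (fun x => (t * χ x) • e2basis j) 2 (volume : Measure E2) := by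
      apply Continuous.memLp_of_hasCompactSupport
      · have := hχ.continuous; fun_prop
      · have : HasCompactSupport (fun x => t * χ x) := hc.mul_left
        exact this.smul_right
    exact h2.add this
  · have : MemLp (fun x => (t • fderiv ℝ χ x).smulRight (e2basis j)) 2 (volume : Measure E2) := by
      apply Continuous.memLp_of_hasCompactSupport
      · have := hχ.continuous_fderiv (by simp)
        have h5 : Continuous fun x => t • fderiv ℝ χ x := this.const_smul t
        have h6 : Continuous fun A : E2 →L[ℝ] ℝ => A.smulRight (e2basis j) :=
          ((ContinuousLinearMap.smulRightL ℝ E2 E2).flip (e2basis j)).continuous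
        exact h6.comp h5
      · have h7 : HasCompactSupport (fderiv ℝ χ) := hc.fderiv (𝕜 := ℝ)
        refine h7.mono fun x hx => ?_
        rw [Function.mem_support] at hx ⊢
        intro h0
        apply hx
        rw [h0]
        ext y
        simp
    have e9 : (fun x => fderiv ℝ (pert v χ j t) x) = (fun x => fderiv ℝ v x) +
        (fun x => (t • fderiv ℝ χ x).smulRight (e2basis j)) :=
      funext fun x => (pert_fderiv h1 hd j t x).fderiv
    rw [e9]
    exact memLp_add_aux h3 this

lemma quartic {p q s τ : ℝ} (h : ∀ t : ℝ, 0 ≤ t * p + t^2 * q + t^3 * s + t^4 * τ) : p = 0 ∧ 0 ≤ q := by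
  have hp : p = 0 := by
    have hd : HasDerivAt (fun t : ℝ => t * p + t^2 * q + t^3 * s + t^4 * τ) p 0 := by
      have := ((((hasDerivAt_id (0:ℝ)).mul_const p).add ((hasDerivAt_pow 2 (0:ℝ)).mul_const q)).add
        ((hasDerivAt_pow 3 (0:ℝ)).mul_const s)).add ((hasDerivAt_pow 4 (0:ℝ)).mul_const τ)
      refine this.congr_deriv ?_
      simp
    have hm : IsLocalMin (fun t : ℝ => t * p + t^2 * q + t^3 * s + t^4 * τ) 0 :=
      Filter.Eventually.of_forall fun t => by simpa using h t
    exact hm.hasDerivAt_eq_zero hd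
  refine ⟨hp, ?_⟩
  subst hp
  have hl : Tendsto (fun t : ℝ => q + t * s + t^2 * τ) (𝓝[>] 0) (𝓝 q) := by
    have : Continuous (fun t : ℝ => q + t * s + t^2 * τ) := by fun_prop
    have := this.tendsto 0
    simp only [zero_mul, add_zero, ne_eq, OfNat.ofNat_ne_zero, not_false_eq_true, zero_pow] at this
    exact this.mono_left nhdsWithin_le_nhds
  refine ge_of_tendsto hl ?_
  filter_upwards [self_mem_nhdsWithin] with t ht
  have ht : 0 < t := ht
  have := h t
  have h2 : 0 ≤ t^2 * (q + t * s + t^2 * τ) := by linarith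
  exact nonneg_of_mul_nonneg_right h2 (by positivity)

section coefs
variable {ε a : ℝ} {μ : E2 → ℝ} {f v : E2 → E2} {χ : E2 → ℝ}

lemma comp_cont (hv : Continuous v) (j : Fin 2) : Continuous fun x => v x j :=
  (EuclideanSpace.proj j : E2 →L[ℝ] ℝ).continuous.comp hv

lemma zcoef_cont (hμ : Continuous μ) (hf : Continuous f) (hv : Continuous v) (j : Fin 2) :
    Continuous (zcoef ε a μ f v j) := by
  have := comp_cont hv j
  have := comp_cont hf j
  unfold zcoef; fun_prop

lemma pdcomp_memLp (hv : MemH1 v) (i j : Fin 2) : MemLp (pd i (fun y => v y j)) 2 (volume : Measure E2) := by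
  have h := hv.2.2
  have e : pd i (fun y => v y j) = fun x => ((EuclideanSpace.proj j : E2 →L[ℝ] ℝ).comp
      (ContinuousLinearMap.apply ℝ E2 (e2basis i))) (fderiv ℝ v x) := by
    funext x; rw [pd_comp hv.1]; rfl
  rw [e]
  exact ContinuousLinearMap.comp_memLp' _ h

lemma pd_prod_int (hv : MemH1 v) (hχ : ContDiff ℝ 1 χ) (hc : HasCompactSupport χ) (i j : Fin 2) :
    Integrable (fun x => pd i (fun y => v y j) x * pd i χ x) (volume : Measure E2) := by
  have h2 : MemLp (pd i χ) 2 (volume : Measure E2) :=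
    (pd_contDiff (m := 0) i hχ (by simp)).continuous.memLp_of_hasCompactSupport (pd_hasCompactSupport hc i)
  exact (pdcomp_memLp hv i j).integrable_mul h2

lemma cP_int (hμ : Continuous μ) (hf : Continuous f) (hv : MemH1 v) (hχ : ContDiff ℝ 1 χ)
    (hc : HasCompactSupport χ) (j : Fin 2) : Integrable (cP ε a μ f v χ j) (volume : Measure E2) := by
  refine Integrable.add (integrable_finsetSum _ fun i _ => pd_prod_int hv hχ hc i j) ?_
  exact integrable_mul_test (zcoef_cont hμ hf hv.1.continuous j) hχ.continuous hc

lemma cQ_int (hμ : Continuous μ) (hv : Continuous v) (hχ : ContDiff ℝ 1 χ)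
    (hc : HasCompactSupport χ) (j : Fin 2) : Integrable (cQ ε μ v χ j) (volume : Measure E2) := by
  have hj := comp_cont hv j
  have hχc := hχ.continuous
  refine Integrable.add (Integrable.const_mul (integrable_finsetSum _ fun i _ => ?_) _) ?_
  · have h0 := (pd_contDiff (m := 0) i hχ (by simp)).continuous
    have := integrable_mul_test h0 h0 (pd_hasCompactSupport hc i)
    refine this.congr (Filter.Eventually.of_forall fun x => ?_)
    simp only [pow_two]
  · have := integrable_mul_test (f := fun x => (1/(4*ε^2)) * (-2 * μ x + 4 * (v x j)^2 + 2 * ‖v x‖^2) * χ x)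
      (by fun_prop) hχc hc
    refine this.congr (Filter.Eventually.of_forall fun x => ?_)
    simp only [pow_two, mul_assoc]

lemma cS_int (hv : Continuous v) (hχ : ContDiff ℝ 1 χ)
    (hc : HasCompactSupport χ) (j : Fin 2) : Integrable (cS ε v χ j) (volume : Measure E2) := by
  have hj := comp_cont hv j
  have hχc := hχ.continuous
  have := integrable_mul_test (f := fun x => (1/ε^2) * v x j * χ x ^ 2) (by fun_prop) hχc hc
  refine this.congr (Filter.Eventually.of_forall fun x => ?_)
  simp only [cS]; ring

lemma cT_int (hχ : ContDiff ℝ 1 χ)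
    (hc : HasCompactSupport χ) : Integrable (cT ε χ) (volume : Measure E2) := by
  have hχc := hχ.continuous
  have := integrable_mul_test (f := fun x => (1/(4*ε^2)) * χ x ^ 3) (by fun_prop) hχc hc
  refine this.congr (Filter.Eventually.of_forall fun x => ?_)
  simp only [cT]; ring

lemma energy_pert (hε : ε ≠ 0) (hμ : Continuous μ) (hf : Continuous f) (hv : MemH1 v) (hχ : ContDiff ℝ 1 χ)
    (hc : HasCompactSupport χ) (j : Fin 2) (t : ℝ)
    (hi : Integrable (dens ε a μ f v) (volume : Measure E2)) :
    energy ε a μ f (pert v χ j t) = energy ε a μ f v + (t * (∫ x, cP ε a μ f v χ j x) + t^2 * (∫ x, cQ ε μ v χ j x)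
      + t^3 * (∫ x, cS ε v χ j x) + t^4 * ∫ x, cT ε χ x) := by
  have e1 : ∀ u, energy ε a μ f u = ∫ x, dens ε a μ f u x := fun u => rfl
  rw [e1, e1]
  have hP := cP_int (ε := ε) (a := a) hμ hf hv hχ hc j
  have hQ := cQ_int (ε := ε) hμ hv.1.continuous hχ hc j
  have hS := cS_int (ε := ε) hv.1.continuous hχ hc j
  have hT := cT_int (ε := ε) hχ hc
  simp_rw [dens_pert hε hv.1 (hχ.differentiable (by simp)) j t]
  rw [integral_add hi, integral_add, integral_add, integral_add, integral_const_mul, integral_const_mul,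
    integral_const_mul, integral_const_mul]
  · exact hP.const_mul _
  · exact hQ.const_mul _
  · exact (hP.const_mul _).add (hQ.const_mul _)
  · exact hS.const_mul _
  · exact ((hP.const_mul _).add (hQ.const_mul _)).add (hS.const_mul _)
  · exact hT.const_mul _
  · exact (((hP.const_mul _).add (hQ.const_mul _)).add (hS.const_mul _)).add (hT.const_mul _)

end coefs

lemma mu_pos {μ : E2 → ℝ} {μrad : ℝ → ℝ} {ρ : ℝ} (hμ : MuHyp μ μrad ρ) {x : E2} (hx : ‖x‖ < ρ) : 0 < μ x := by
  have hanti : StrictAntiOn μrad (Ici 0) := by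
    apply strictAntiOn_of_deriv_neg (convex_Ici 0) hμ.smooth_rad.continuous.continuousOn
    intro r hr
    rw [interior_Ici] at hr
    exact hμ.deriv_neg r hr
  rw [hμ.radial, ← hμ.rho_root]
  exact hanti (norm_nonneg x) hμ.rho_pos.le hx

lemma memLp_zero_aux {F : Type*} [NormedAddCommGroup F] : MemLp (fun _ : E2 => (0 : F)) 2 (volume : Measure E2) :=
  MemLp.zero'

lemma memH1_zero : MemH1 (fun _ => (0 : E2)) := by
  refine ⟨differentiable_const _, MemLp.zero', ?_⟩
  have : (fun x : E2 => fderiv ℝ (fun _ : E2 => (0 : E2)) x) = fun _ => 0 := by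
    funext x; simp
  rw [this]
  exact memLp_zero_aux

lemma dens_zero (ε a : ℝ) (μ : E2 → ℝ) (f : E2 → E2) : dens ε a μ f (fun _ => 0) = fun _ => 0 := by
  funext x; simp [dens, gradSq]

lemma dens_integrable {μ : E2 → ℝ} {μrad : ℝ → ℝ} {ρ : ℝ} (hμ : MuHyp μ μrad ρ) {f : E2 → E2} (hf : Continuous f) :
    ∃ ε0 : ℝ, 0 < ε0 ∧ ∀ (ε a : ℝ) (v : E2 → E2), 0 < ε → ε < ε0 → IsMinimizer ε a μ f v →
      Integrable (dens ε a μ f v) (volume : Measure E2) := by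
  have hρ := hμ.rho_pos
  let b : ContDiffBump (0 : E2) := ⟨ρ/4, ρ/2, by linarith, by linarith⟩
  have hb : ContDiff ℝ 1 b := b.contDiff
  have hbc : HasCompactSupport b := b.hasCompactSupport
  have hμc := hμ.smooth.continuous
  have i2 : Integrable (fun x => μ x * b x * b x) (volume : Measure E2) :=
    integrable_mul_test (hμc.mul hb.continuous) hb.continuous hbc
  have i1 : Integrable (fun x => ∑ i, pd i b x ^ 2) (volume : Measure E2) := by
    refine integrable_finsetSum _ fun i _ => ?_
    have h0 := (pd_contDiff (m := 0) i hb (by simp)).continuous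
    refine (integrable_mul_test h0 h0 (pd_hasCompactSupport hbc i)).congr (Filter.Eventually.of_forall fun x => ?_)
    simp only [pow_two]
  set I1 := ∫ x, ∑ i, pd i b x ^ 2 with hI1
  set I2 := ∫ x, μ x * b x * b x with hI2
  have h1 : 0 ≤ I1 := integral_nonneg fun x => Finset.sum_nonneg fun i _ => sq_nonneg _
  have h2 : 0 < I2 := by
    apply Continuous.integral_pos_of_hasCompactSupport_nonneg_nonzero (x := 0)
    · exact (hμc.mul hb.continuous).mul hb.continuous
    · exact hbc.mul_left
    · intro x
      show 0 ≤ μ x * b x * b x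
      by_cases hx : ‖x‖ < ρ
      · have := mu_pos hμ hx
        have := b.nonneg (x := x)
        positivity
      · have : b x = 0 := b.zero_of_le_dist (by
          rw [dist_zero_right]; show ρ/2 ≤ _; push Not at hx; linarith)
        simp [this]
    · have e0 : b 0 = 1 := b.one_of_mem_closedBall (by
        rw [Metric.mem_closedBall, dist_self]; show 0 ≤ ρ/4; linarith)
      have := mu_pos hμ (x := 0) (by simpa using hρ)
      rw [e0]; simp; exact this.ne'
  refine ⟨√(I2 / (I1 + 1)), by positivity, fun ε a v hε hε0 hv => ?_⟩
  have hsq : ε^2 * (I1 + 1) < I2 := by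
    have := (Real.lt_sqrt hε.le).1 hε0
    rwa [lt_div_iff₀ (by linarith)] at this
  by_contra hni
  have ev : energy ε a μ f v = 0 := integral_undef hni
  have key : ∀ t : ℝ, 0 ≤ t * (∫ x, cP ε a μ f (fun _ => 0) b 0 x) + t^2 * (∫ x, cQ ε μ (fun _ => 0) b 0 x)
      + t^3 * (∫ x, cS ε (fun _ => 0) b 0 x) + t^4 * ∫ x, cT ε b x := by
    intro t
    have h3 := hv.2 _ (pert_memH1 memH1_zero hb hbc 0 t)
    rw [ev, energy_pert hε.ne' hμc hf memH1_zero hb hbc 0 t (by rw [dens_zero]; exact integrable_zero _ _ _)] at h3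
    have e0 : energy ε a μ f (fun _ => 0) = 0 := by
      show ∫ x, dens ε a μ f (fun _ => 0) x = 0
      rw [dens_zero]; simp
    rw [e0, zero_add] at h3
    exact h3
  have hq := (quartic key).2
  have eq : ∫ x, cQ ε μ (fun _ => 0) b 0 x = (1/2) * I1 - (1/(2*ε^2)) * I2 := by
    rw [hI1, hI2, ← integral_const_mul, ← integral_const_mul, ← integral_sub (i1.const_mul _) (i2.const_mul _)]
    congr 1
    funext x
    simp only [cQ]
    simp
    field_simp
    ring
  rw [eq] at hq
  have : (1/2) * I1 - (1/(2*ε^2)) * I2 = (1/(2*ε^2)) * (ε^2 * I1 - I2) := by field_simp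
  rw [this] at hq
  have h5 : 0 ≤ ε^2 * I1 - I2 := nonneg_of_mul_nonneg_right hq (by positivity)
  nlinarith [sq_nonneg ε]

lemma weak_eq {ε a : ℝ} {μ : E2 → ℝ} {f v : E2 → E2} (hε : 0 < ε) (hμ : Continuous μ) (hf : Continuous f)
    (hv : IsMinimizer ε a μ f v) (hi : Integrable (dens ε a μ f v) (volume : Measure E2)) (j : Fin 2) :
    WeakLap (fun x => v x j) (zcoef ε a μ f v j) := by
  intro χ hχ hc
  have hχ1 : ContDiff ℝ 1 χ := contDiff_infty.1 hχ 1
  have hχ2 : ContDiff ℝ 2 χ := contDiff_infty.1 hχ 2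
  have key : ∀ t : ℝ, 0 ≤ t * (∫ x, cP ε a μ f v χ j x) + t^2 * (∫ x, cQ ε μ v χ j x)
      + t^3 * (∫ x, cS ε v χ j x) + t^4 * ∫ x, cT ε χ x := by
    intro t
    have h3 := hv.2 _ (pert_memH1 hv.1 hχ1 hc j t)
    rw [energy_pert hε.ne' hμ hf hv.1 hχ1 hc j t hi] at h3
    linarith
  have hp := (quartic key).1
  have hj : Differentiable ℝ (fun x => v x j) := (EuclideanSpace.proj j : E2 →L[ℝ] ℝ).differentiable.comp hv.1.1
  have hz := integrable_mul_test (zcoef_cont (ε := ε) (a := a) hμ hf hv.1.1.continuous j) hχ.continuous hc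
  simp only [cP] at hp
  rw [integral_add (integrable_finsetSum _ fun i _ => pd_prod_int hv.1 hχ1 hc i j) hz,
    integral_finsetSum _ fun i _ => pd_prod_int hv.1 hχ1 hc i j] at hp
  have hib : ∀ i, ∫ x, v x j * pd i (pd i χ) x = - ∫ x, pd i (fun y => v y j) x * pd i χ x := fun i =>
    ibp hj (pd_contDiff i hχ2 (by norm_num)) (pd_hasCompactSupport hc i) i (pd_prod_int hv.1 hχ1 hc i j)
  have hl : ∫ x, v x j * lapV χ x = ∑ i, ∫ x, v x j * pd i (pd i χ) x := by
    rw [← integral_finsetSum]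
    · simp only [lapV, Finset.mul_sum]
    · intro i _
      exact integrable_mul_test hj.continuous (pd_contDiff (m := 0) i (pd_contDiff (m := 1) i hχ2 (by norm_num)) (by norm_num)).continuous
        (pd_hasCompactSupport (pd_hasCompactSupport hc i) i)
  rw [hl]
  simp only [hib, Finset.sum_neg_distrib]
  linarith

lemma lap_comp {v : E2 → E2} (hv : ContDiff ℝ 2 v) (j : Fin 2) (x : E2) :
    (lapV v x) j = lapV (fun y => v y j) x := by
  have hd : Differentiable ℝ v := hv.differentiable (by norm_num)
  have e1 : ∀ i, pd i (fun y => v y j) = fun x => (pd i v x) j := fun i => funext (pd_comp hd i j)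
  have hd2 : ∀ i, Differentiable ℝ (pd i v) := fun i =>
    (pd_contDiff (m := 1) i hv (by norm_num)).differentiable (by norm_num)
  simp only [lapV, e1, pd_comp (hd2 _), Fin.sum_univ_two]
  simp

lemma min_solution {ε a : ℝ} {μ : E2 → ℝ} {f v : E2 → E2} (hε : 0 < ε) (hμ : ContDiff ℝ (⊤ : ℕ∞) μ)
    (hf : ContDiff ℝ (⊤ : ℕ∞) f)
    (hv : IsMinimizer ε a μ f v) (hi : Integrable (dens ε a μ f v) (volume : Measure E2)) :
    IsSolution ε a μ f v := by
  have hw := weak_eq hε hμ.continuous hf.continuous hv hi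
  have hvc := hv.1.1.continuous
  have hall : ∀ n : ℕ, ContDiff ℝ n v := by
    intro n
    induction n with
    | zero => exact contDiff_zero.2 hvc
    | succ n ih =>
      rw [contDiff_euclidean]
      intro j
      refine regularity n (comp_cont hvc j) ?_ (hw j)
      have h1 := contDiff_euclidean.1 ih j
      have h2 := contDiff_euclidean.1 (contDiff_infty.1 hf n) j
      have h3 := contDiff_infty.1 hμ n
      have h4 : ContDiff ℝ n (fun x => ‖v x‖^2) := ih.norm_sq ℝ
      exact (((contDiff_const.mul h3).mul h1).add ((contDiff_const.mul h4).mul h1)).sub (contDiff_const.mul h2)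
  refine ⟨contDiff_infty.2 hall, fun x => ?_⟩
  have h2 : ContDiff ℝ 2 v := hall 2
  ext j
  have h3 : (lapV v x) j = zcoef ε a μ f v j x := by
    rw [lap_comp h2, WeakLap.eq (contDiff_euclidean.1 h2 j) (zcoef_cont hμ.continuous hf.continuous hvc j) (hw j)]
  have h4 : (lap v x) j = zcoef ε a μ f v j x := h3
  simp [h4, zcoef]
  field_simp
  ring

/-- rotation to the local frame -/
def rot (e : E2) : E2 →L[ℝ] E2 :=
  (EuclideanSpace.proj 0 : E2 →L[ℝ] ℝ).smulRight e + (EuclideanSpace.proj 1 : E2 →L[ℝ] ℝ).smulRight (perp e)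

lemma rot_apply (e s : E2) : rot e s = s 0 • e + s 1 • perp e := rfl

lemma rot_zero (e : E2) : rot e (e2basis 0) = e := by
  rw [rot_apply]; simp [e2basis]

lemma rot_one (e : E2) : rot e (e2basis 1) = perp e := by
  rw [rot_apply]; simp [e2basis]

lemma norm_sq_e2 (e : E2) : ‖e‖^2 = e 0 ^ 2 + e 1 ^ 2 := by
  rw [EuclideanSpace.norm_sq_eq]; simp [Fin.sum_univ_two]

lemma perp_zero (e : E2) : perp e 0 = - e 1 := by simp [perp]
lemma perp_one (e : E2) : perp e 1 = e 0 := by simp [perp]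

lemma norm_perp (e : E2) : ‖perp e‖ = ‖e‖ := by
  have : ‖perp e‖^2 = ‖e‖^2 := by
    rw [norm_sq_e2, norm_sq_e2, perp_zero, perp_one]; ring
  exact (pow_left_inj₀ (norm_nonneg _) (norm_nonneg _) two_ne_zero).1 this

section affine
variable {V : Type*} [NormedAddCommGroup V] [NormedSpace ℝ V]

lemma pd_affine {u : E2 → V} (hu : Differentiable ℝ u) (p : E2) (l : ℝ) (A : E2 →L[ℝ] E2) (i : Fin 2) (r : ℝ) :
    pd i (fun s => r • u (p + l • A s)) = fun s => (r * l) • fderiv ℝ u (p + l • A s) (A (e2basis i)) := by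
  funext s
  have h1 : HasFDerivAt (fun s => p + l • A s) (l • A) s := by
    exact ((A.hasFDerivAt (x := s)).const_smul l).const_add p
  have h2 := (((hu _).hasFDerivAt (x := p + l • A s)).comp s h1).const_smul r
  have h3 : HasFDerivAt (fun s => r • u (p + l • A s)) (r • (fderiv ℝ u (p + l • A s)).comp (l • A)) s := h2
  simp only [pd, h3.fderiv]
  simp [mul_smul]

lemma affine_smooth {u : E2 → V} {n : WithTop ℕ∞} (hu : ContDiff ℝ n u) (p : E2) (l : ℝ) (A : E2 →L[ℝ] E2) (r : ℝ) :
    ContDiff ℝ n (fun s => r • u (p + l • A s)) := by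
  have h1 : ContDiff ℝ n (fun s => p + l • A s) := contDiff_const.add (A.contDiff.const_smul l)
  exact contDiff_const.smul (hu.comp h1)

lemma lapV_affine {u : E2 → V} (hu : ContDiff ℝ 2 u) (p : E2) (l : ℝ) {e : E2} (he : ‖e‖ = 1) (r : ℝ) (s : E2) :
    lapV (fun s => r • u (p + l • rot e s)) s = (r * l ^ 2) • lapV u (p + l • rot e s) := by
  have hd : Differentiable ℝ u := hu.differentiable (by norm_num)
  have hd2 : ∀ b : E2, Differentiable ℝ (fun x => fderiv ℝ u x b) := fun b =>
    ((hu.fderiv_right (m := 1) (by norm_num)).clm_apply contDiff_const).differentiable (by norm_num)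
  have hd3 : DifferentiableAt ℝ (fderiv ℝ u) (p + l • rot e s) :=
    (hu.fderiv_right (m := 1) (by norm_num)).differentiable (by norm_num) _
  have e3 : ∀ b c : E2, fderiv ℝ (fun x => fderiv ℝ u x b) (p + l • rot e s) c =
      fderiv ℝ (fderiv ℝ u) (p + l • rot e s) c b := by
    intro b c
    rw [fderiv_clm_apply hd3 (differentiableAt_const _)]
    simp
  have hs : e 0 ^ 2 + e 1 ^ 2 = 1 := by rw [← norm_sq_e2, he]; norm_num
  simp only [lapV, pd_pd_eq hu, Fin.sum_univ_two]
  simp only [pd_affine hd, pd_affine (hd2 _), e3, rot_zero, rot_one]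
  generalize fderiv ℝ (fderiv ℝ u) (p + l • rot e s) = B
  have h0 : e = e 0 • e2basis 0 + e 1 • e2basis 1 := e2_decomp e
  have h1 : perp e = (-(e 1)) • e2basis 0 + e 0 • e2basis 1 := by
    have := e2_decomp (perp e)
    rwa [perp_zero, perp_one] at this
  have hB : B e e + B (perp e) (perp e) = B (e2basis 0) (e2basis 0) + B (e2basis 1) (e2basis 1) := by
    rw [h1]
    nth_rewrite 1 [h0]
    nth_rewrite 3 [h0]
    simp only [map_add, map_smul, add_apply, smul_apply]
    set B00 := B (e2basis 0) (e2basis 0)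
    set B11 := B (e2basis 1) (e2basis 1)
    set B01 := B (e2basis 0) (e2basis 1)
    set B10 := B (e2basis 1) (e2basis 0)
    have : B00 + B11 = (e 0 ^ 2 + e 1 ^ 2) • (B00 + B11) := by rw [hs, one_smul]
    rw [this]
    module
  rw [← smul_add, hB]
  congr 1
  ring

lemma affine_LBk (p : E2) (l : ℕ → ℝ) (hl : ∀ n, |l n| ≤ 1) (A : E2 →L[ℝ] E2) (k : ℕ) :
    ∀ {G : E2 → V}, ContDiff ℝ (⊤ : ℕ∞) G → ∀ {r : ℕ → ℝ} {C : ℝ}, (∀ n, |r n| ≤ C) →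
      LBk k (fun n s => r n • G (p + l n • A s)) := by
  have base : ∀ {G : E2 → V}, ContDiff ℝ (⊤ : ℕ∞) G → ∀ {r : ℕ → ℝ} {C : ℝ}, (∀ n, |r n| ≤ C) →
      LB (fun n s => r n • G (p + l n • A s)) := by
    intro G hG r C hr R
    obtain ⟨D, hD⟩ := (isCompact_closedBall (0 : E2) (‖p‖ + ‖A‖ * |R|)).exists_bound_of_continuousOn
      hG.continuous.continuousOn
    refine ⟨C * D, fun n x hx => ?_⟩
    rw [norm_smul, Real.norm_eq_abs]
    have hC : 0 ≤ C := (abs_nonneg _).trans (hr n)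
    refine mul_le_mul (hr n) (hD _ ?_) (norm_nonneg _) hC
    rw [mem_closedBall_zero_iff] at hx ⊢
    refine (norm_add_le _ _).trans (add_le_add le_rfl ?_)
    rw [norm_smul, Real.norm_eq_abs]
    have h1 : ‖A x‖ ≤ ‖A‖ * |R| := (A.le_opNorm x).trans
      (mul_le_mul_of_nonneg_left (hx.trans (le_abs_self R)) (norm_nonneg _))
    calc |l n| * ‖A x‖ ≤ 1 * (‖A‖ * |R|) := mul_le_mul (hl n) h1 (norm_nonneg _) zero_le_one
      _ = _ := one_mul _
  induction k with
  | zero => intro G hG r C hr; exact base hG hr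
  | succ k ih =>
    intro G hG r C hr
    refine ⟨base hG hr, fun i => ?_⟩
    simp only [pd_affine (smooth_diff hG)]
    refine ih (G := fun x => fderiv ℝ G x (A (e2basis i))) ((hG.fderiv_right (by simp)).clm_apply contDiff_const) (C := C) ?_
    intro n
    rw [abs_mul]
    calc |r n| * |l n| ≤ C * 1 := mul_le_mul (hr n) (hl n) (abs_nonneg _) ((abs_nonneg _).trans (hr n))
      _ = C := mul_one C

end affine

lemma coef_LBk {μ : E2 → ℝ} (hμ : ContDiff ℝ (⊤ : ℕ∞) μ) (p : E2) (hp : μ p = 0) (l : ℕ → ℝ) (hl : ∀ n, |l n| ≤ 1)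
    (hl0 : ∀ n, 0 < l n) (A : E2 →L[ℝ] E2) (m : ℝ) (k : ℕ) :
    LBk (k + 1) (fun n s => (1 / (m * l n)) • μ (p + l n • A s)) := by
  have hpd : ∀ i, LBk k (fun n => pd i (fun s => (1 / (m * l n)) • μ (p + l n • A s))) := by
    intro i
    simp only [pd_affine (smooth_diff hμ)]
    refine affine_LBk p l hl A k (G := fun x => fderiv ℝ μ x (A (e2basis i)))
      ((hμ.fderiv_right (by simp)).clm_apply contDiff_const) (C := |1 / m|) ?_
    intro n
    have : 1 / (m * l n) * l n = 1 / m := by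
      have := (hl0 n).ne'
      rw [one_div, mul_inv, one_div, mul_assoc, inv_mul_cancel₀ this, mul_one]
    rw [this]
  refine ⟨?_, hpd⟩
  intro R
  obtain ⟨C0, h0⟩ := (hpd 0).lb R
  obtain ⟨C1, h1⟩ := (hpd 1).lb R
  refine ⟨(C0 + C1) * R, fun n x hx => ?_⟩
  have hR : 0 ≤ R := (norm_nonneg x).trans (mem_closedBall_zero_iff.1 hx)
  have hd := smooth_diff (affine_smooth hμ p (l n) A (1 / (m * l n)))
  have := (convex_closedBall (0 : E2) R).norm_image_sub_le_of_norm_fderiv_le (𝕜 := ℝ)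
    (f := fun s => (1 / (m * l n)) • μ (p + l n • A s)) (C := C0 + C1) (fun y _ => hd y)
    (fun y hy => (norm_clm_le _).trans (add_le_add (h0 n y hy) (h1 n y hy)))
    (Metric.mem_closedBall_self hR) hx
  simp only [map_zero, smul_zero, add_zero, hp, sub_zero] at this
  refine this.trans (mul_le_mul_of_nonneg_left (mem_closedBall_zero_iff.1 hx) ?_)
  exact add_nonneg ((norm_nonneg _).trans (h0 n x hx)) ((norm_nonneg _).trans (h1 n x hx))

section radial
variable {μ : E2 → ℝ} {μrad : ℝ → ℝ} {ρ : ℝ}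

lemma mu_line (hμ : MuHyp μ μrad ρ) {e : E2} (he : ‖e‖ = 1) (r : ℝ) : μ (r • e) = μrad r := by
  rw [hμ.radial, norm_smul, he, mul_one, Real.norm_eq_abs]
  rcases abs_choice r with h | h <;> rw [h]
  exact hμ.even_rad r

lemma mu_deriv_e (hμ : MuHyp μ μrad ρ) {e : E2} (he : ‖e‖ = 1) : fderiv ℝ μ (ρ • e) e = deriv μrad ρ := by
  have h1 := hasDerivAt_line (smooth_diff hμ.smooth) 0 e ρ
  simp only [zero_add, mu_line hμ he] at h1
  exact h1.deriv.symm

lemma mu_deriv_perp (hμ : MuHyp μ μrad ρ) (e : E2) : fderiv ℝ μ (ρ • e) (perp e) = 0 := by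
  have h1 := hasDerivAt_line (smooth_diff hμ.smooth) (ρ • e) (perp e) 0
  have h2 := hasDerivAt_line_neg (smooth_diff hμ.smooth) (ρ • e) (perp e) 0
  have e1 : (fun t : ℝ => μ (ρ • e + t • perp e)) = fun t : ℝ => μ (ρ • e - t • perp e) := by
    funext t
    rw [hμ.radial, hμ.radial]
    congr 1
    apply (pow_left_inj₀ (norm_nonneg _) (norm_nonneg _) two_ne_zero).1
    rw [norm_sq_e2, norm_sq_e2]
    simp [perp_zero, perp_one]
    ring
  rw [e1] at h1
  have := h1.unique h2
  simp only [zero_smul, add_zero, sub_zero] at this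
  linarith

lemma coef_tendsto (hμ : MuHyp μ μrad ρ) {e : E2} (he : ‖e‖ = 1) (l : ℕ → ℝ) (hl0 : ∀ n, 0 < l n)
    (hl : Tendsto l atTop (𝓝 0)) (s : E2) :
    Tendsto (fun n => (1 / (deriv μrad ρ * l n)) • μ (ρ • e + l n • rot e s)) atTop (𝓝 (s 0)) := by
  have hm : deriv μrad ρ ≠ 0 := (hμ.deriv_neg ρ hμ.rho_pos).ne
  have h1 := hasDerivAt_line (smooth_diff hμ.smooth) (ρ • e) (rot e s) 0
  have h2 := h1.tendsto_slope_zero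
  have h3 : Tendsto l atTop (𝓝[≠] 0) :=
    tendsto_nhdsWithin_iff.2 ⟨hl, Filter.Eventually.of_forall fun n => (hl0 n).ne'⟩
  have h4 := (h2.comp h3).const_mul (1 / deriv μrad ρ)
  have e0 : μ (ρ • e) = 0 := by rw [mu_line hμ he, hμ.rho_root]
  have e1 : fderiv ℝ μ (ρ • e + (0:ℝ) • rot e s) (rot e s) = s 0 * deriv μrad ρ := by
    rw [zero_smul, add_zero, rot_apply, map_add, map_smul, map_smul, mu_deriv_e hμ he, mu_deriv_perp hμ]
    simp
  rw [e1] at h4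
  have e2 : 1 / deriv μrad ρ * (s 0 * deriv μrad ρ) = s 0 := by field_simp
  rw [e2] at h4
  refine h4.congr fun n => ?_
  have := (hl0 n).ne'
  simp [e0]
  field_simp

end radial

lemma scal_facts {ε m : ℝ} (hε : 0 < ε) (hm : 0 < m) :
    0 < ε^((2:ℝ)/3) / m^((1:ℝ)/3) ∧ 0 < (2:ℝ)^(-(1/2:ℝ)) * (m*ε)^(-(1/3:ℝ)) ∧
    (ε^((2:ℝ)/3) / m^((1:ℝ)/3))^3 * m = ε^2 ∧
    ε^((2:ℝ)/3) / m^((1:ℝ)/3) = √2 * ((2:ℝ)^(-(1/2:ℝ)) * (m*ε)^(-(1/3:ℝ))) * ε := by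
  refine ⟨by positivity, by positivity, ?_, ?_⟩
  · rw [div_pow, ← Real.rpow_natCast, ← Real.rpow_mul hε.le, ← Real.rpow_natCast (m ^ _), ← Real.rpow_mul hm.le]
    norm_num
    field_simp
  · rw [Real.sqrt_eq_rpow, ← mul_assoc, ← Real.rpow_add two_pos, Real.mul_rpow hm.le hε.le, Real.rpow_neg hm.le,
      div_eq_mul_inv]
    have : ε^((2:ℝ)/3) = ε^(-(1/3:ℝ)) * ε := by
      nth_rewrite 3 [← Real.rpow_one ε]
      rw [← Real.rpow_add hε]; norm_num
    rw [this]
    norm_num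
    ring

lemma rescaled_eq {ε a l κ μ1 : ℝ} {μ : E2 → ℝ} {f v : E2 → E2} (hs : IsSolution ε a μ f v) (hε : 0 < ε) (hm : μ1 < 0)
    (hl : 0 < l) (hκ : 0 < κ) (h1 : l ^ 3 * (-μ1) = ε ^ 2) (h2 : l = √2 * κ * ε) (p : E2) {e : E2} (he : ‖e‖ = 1) (s : E2) :
    lapV (fun s => κ • v (p + l • rot e s)) s = ((1 / (μ1 * l)) • μ (p + l • rot e s)) • (κ • v (p + l • rot e s))
      + (2 * ‖κ • v (p + l • rot e s)‖ ^ 2) • (κ • v (p + l • rot e s)) + (a / (√2 * μ1)) • f (p + l • rot e s) := by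
  rw [lapV_affine (contDiff_infty.1 hs.1 2) p l he]
  have h3 := hs.2 (p + l • rot e s)
  have h4 : lap v (p + l • rot e s) = lapV v (p + l • rot e s) := rfl
  rw [h4] at h3
  generalize p + l • rot e s = X at *
  have h5 : lapV v X = (1/ε^2) • (‖v X‖^2 • v X - μ X • v X - (ε*a) • f X) := by
    have : ε^2 • lapV v X = ‖v X‖^2 • v X - μ X • v X - (ε*a) • f X := by
      rw [← sub_eq_zero, ← h3]; module
    rw [← this, smul_smul]
    field_simp
    simp
  have hsq : √2 ^ 2 = 2 := Real.sq_sqrt (by norm_num)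
  have hs2 : 0 < √2 := by positivity
  have c1 : κ * l^2 * (1/ε^2) = κ * (-1 / (μ1 * l)) := by
    rw [← h1]; field_simp
  have c2 : l^2 = 2 * κ^2 * ε^2 := by rw [h2, mul_pow, mul_pow, hsq]
  have c3 : κ * l^2 * (1/ε^2) * (ε * a) = - (a / (√2 * μ1)) := by
    rw [c1]
    nth_rewrite 1 [h2]
    field_simp
  have c4 : κ * l^2 * (1/ε^2) = 2 * κ^2 * κ := by
    rw [c2]; field_simp
  rw [h5, smul_smul, smul_sub, smul_sub, smul_smul _ (ε * a), c3, norm_smul, Real.norm_eq_abs, mul_pow, sq_abs]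
  rw [c4]
  nth_rewrite 2 [← c4]
  rw [c1]
  simp only [smul_smul, smul_eq_mul]
  rw [sub_eq_add_neg, sub_eq_add_neg, ← neg_smul, ← neg_smul, neg_neg]
  congr 1
  rw [add_comm]
  congr 1 <;> congr 1 <;> ring

lemma compactness {W : ℕ → E2 → E2} {c : ℕ → E2 → ℝ} {h : ℕ → E2 → E2} {c' : E2 → ℝ} {h' : E2 → E2}
    (sW : ∀ n, ContDiff ℝ (⊤ : ℕ∞) (W n)) (sc : ∀ n, ContDiff ℝ (⊤ : ℕ∞) (c n))
    (sh : ∀ n, ContDiff ℝ (⊤ : ℕ∞) (h n)) (bc : LBk 2 c) (bh : LBk 2 h)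
    (heq : ∀ n s, lapV (W n) s = c n s • W n s + (2 * ‖W n s‖ ^ 2) • W n s + h n s)
    (lc : ∀ s, Tendsto (fun n => c n s) atTop (𝓝 (c' s))) (lh : ∀ s, Tendsto (fun n => h n s) atTop (𝓝 (h' s))) :
    ∃ φ : ℕ → ℕ, StrictMono φ ∧ ∃ y, TendstoC2LocSeq (fun n => W (φ n)) y ∧ ContDiff ℝ 2 y ∧
      ∀ s, lapV y s = c' s • y s + (2 * ‖y s‖ ^ 2) • y s + h' s := by
  have bW : LB W := by
    intro R
    obtain ⟨M, hM⟩ := bc.lb (R + 1)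
    obtain ⟨H, hH⟩ := bh.lb (R + 1)
    refine ⟨8 + |M| + |H|, fun n x hx => ?_⟩
    have hsub : ∀ y ∈ Metric.ball x 1, y ∈ Metric.closedBall (0 : E2) (R + 1) := by
      intro y hy
      rw [mem_closedBall_zero_iff] at hx ⊢
      have := mem_ball_iff_norm.1 hy
      have h2 : ‖y‖ ≤ ‖y - x‖ + ‖x‖ := by simpa using norm_add_le (y - x) x
      linarith
    have := keller_osserman (contDiff_infty.1 (sW n) 2) x (c n) (h n) |M| |H| (abs_nonneg _) (abs_nonneg _)
      (fun y _ => heq n y)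
      (fun y hy => by
        have h1 := hM n y (hsub y hy)
        rw [Real.norm_eq_abs] at h1
        have := neg_abs_le (c n y)
        have := le_abs_self M
        linarith)
      (fun y hy => (hH n y (hsub y hy)).trans (le_abs_self H))
    nlinarith [sq_nonneg (‖W n x‖ - 1), norm_nonneg (W n x)]
  let P : Fin 2 → (E2 →L[ℝ] ℝ) := fun j => EuclideanSpace.proj j
  let u : Fin 2 → ℕ → E2 → ℝ := fun j n s => P j (W n s)
  have su : ∀ j n, ContDiff ℝ (⊤ : ℕ∞) (u j n) := fun j n => (P j).contDiff.comp (sW n)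
  have bu : ∀ j, LB (u j) := fun j => bW.clm (P j)
  have sH : ∀ j n, ContDiff ℝ (⊤ : ℕ∞) (fun s => P j (h n s)) := fun j n => (P j).contDiff.comp (sh n)
  have hlap : ∀ j, (fun n => lapV (u j n)) = fun n s => (c n s * u j n s +
      ((u 0 n s * u 0 n s + u 0 n s * u 0 n s) * u j n s + (u 1 n s * u 1 n s + u 1 n s * u 1 n s) * u j n s))
      + P j (h n s) := by
    intro j
    funext n s
    have e1 : lapV (u j n) s = (lapV (W n) s) j := (lap_comp (contDiff_infty.1 (sW n) 2) j s).symm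
    have e2 : ∀ i, u i n s = W n s i := fun i => rfl
    have e3 : P j (h n s) = h n s j := rfl
    rw [e1, heq, norm_sq_e2, e2, e2, e2, e3]
    simp
    ring
  have step : ∀ k, LBk k c → LBk k h → (∀ j, LBk k (u j)) → ∀ j, LBk (k + 1) (u j) := by
    intro k hc hh hu j
    refine LBk.of_lap (su j) (bu j) ?_
    rw [hlap j]
    have q : ∀ i, LBk k (fun n s => (u i n s * u i n s + u i n s * u i n s) * u j n s) := fun i =>
      LBk.mul (fun n => ((su i n).mul (su i n)).add ((su i n).mul (su i n))) (su j)
        (LBk.add (fun n => (su i n).mul (su i n)) (fun n => (su i n).mul (su i n))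
          (LBk.mul (su i) (su i) (hu i) (hu i)) (LBk.mul (su i) (su i) (hu i) (hu i))) (hu j)
    have sq : ∀ i n, ContDiff ℝ (⊤ : ℕ∞) (fun s => (u i n s * u i n s + u i n s * u i n s) * u j n s) := fun i n =>
      (((su i n).mul (su i n)).add ((su i n).mul (su i n))).mul (su j n)
    exact LBk.add (fun n => ((sc n).mul (su j n)).add ((sq 0 n).add (sq 1 n))) (sH j)
      (LBk.add (fun n => (sc n).mul (su j n)) (fun n => (sq 0 n).add (sq 1 n)) (LBk.mul sc (su j) hc (hu j))
        (LBk.add (sq 0) (sq 1) (q 0) (q 1))) (LBk.clm (P j) sh hh)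
  have b1 := step 0 bc.pred.pred bh.pred.pred bu
  have b2 := step 1 bc.pred bh.pred b1
  have b3 := step 2 bc bh b2
  have bW3 : LBk 3 W := by
    let Q : Fin 2 → (ℝ →L[ℝ] E2) := fun j => (ContinuousLinearMap.id ℝ ℝ).smulRight (e2basis j)
    have e : W = fun n s => Q 0 (u 0 n s) + Q 1 (u 1 n s) := by
      funext n s
      exact e2_decomp (W n s)
    rw [e]
    exact LBk.add (fun n => (Q 0).contDiff.comp (su 0 n)) (fun n => (Q 1).contDiff.comp (su 1 n))
      (LBk.clm (Q 0) (su 0) (b3 0)) (LBk.clm (Q 1) (su 1) (b3 1))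
  obtain ⟨φ, hφ, y, hy, sy⟩ := c2_compact sW bW3
  refine ⟨φ, hφ, y, hy, sy, fun s => ?_⟩
  have t0 : Tendsto (fun n => W (φ n) s) atTop (𝓝 (y s)) :=
    (tendstoLocallyUniformlyOn_univ.2 hy.1).tendsto_at (mem_univ s)
  have t2 : Tendsto (fun n => fderiv ℝ (fderiv ℝ (W (φ n))) s) atTop (𝓝 (fderiv ℝ (fderiv ℝ y) s)) :=
    (tendstoLocallyUniformlyOn_univ.2 hy.2.2).tendsto_at (mem_univ s)
  have tl : Tendsto (fun n => lapV (W (φ n)) s) atTop (𝓝 (lapV y s)) := by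
    simp only [lapV, pd_pd_eq sy, pd_pd_eq (contDiff_infty.1 (sW _) 2)]
    refine tendsto_finsetSum _ fun i _ => ?_
    have g1 := ((ContinuousLinearMap.apply ℝ (E2 →L[ℝ] E2) (e2basis i)).continuous.tendsto _).comp t2
    exact ((ContinuousLinearMap.apply ℝ E2 (e2basis i)).continuous.tendsto _).comp g1
  have tc := (lc s).comp hφ.tendsto_atTop
  have th := (lh s).comp hφ.tendsto_atTop
  have tr := ((tc.smul t0).add ((((t0.norm).pow 2).const_mul 2).smul t0)).add th
  refine tendsto_nhds_unique tl (tr.congr fun n => ?_)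
  exact (heq (φ n) s).symm

lemma halfplane {y : E2 → E2} (hy : ContDiff ℝ 2 y) (h : E2)
    (heq : ∀ s, lapV y s = s 0 • y s + (2 * ‖y s‖ ^ 2) • y s + h) (s₀ : ℝ) :
    ∃ C : ℝ, ∀ s : E2, s₀ ≤ s 0 → ‖y s‖ ≤ C := by
  refine ⟨8 + (|s₀| + 1) + ‖h‖, fun s hs => ?_⟩
  have := keller_osserman hy s (fun s => s 0) (fun _ => h) (|s₀| + 1) ‖h‖ (by positivity) (norm_nonneg _)
      (fun y _ => heq y)
      (fun z hz => by
        have h1 := mem_ball_iff_norm.1 hz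
        have h2 := (abs_coord_le (z - s) 0).trans h1.le
        have h3 := (abs_le.1 h2).1
        simp only [PiLp.sub_apply] at h3
        have := neg_abs_le s₀
        show _ ≤ z 0
        linarith)
      (fun _ _ => le_rfl)
  nlinarith [sq_nonneg (‖y s‖ - 1), norm_nonneg (y s)]

/-- near a point `ξ = ρe^{iθ}` of the circle `|x| = ρ`, the rescaled
minimizers `w_{ε,a}(s) = 2^{-1/2}(−μ₁ε)^{-1/3} v_{ε,a}(ξ + ε^{2/3}s/(−μ₁)^{1/3})`
(with `s` in the basis `(e^{iθ}, ie^{iθ})`) converge, along a subsequence, in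
`C²_loc(ℝ²,ℝ²)` to a solution of the generalized second Painlevé equation
`Δy − s₁y − 2|y|²y − α = 0`, `α = a₀ f(ξ)/(√2 μ₁)`, bounded on right half-planes. -/
theorem statement2
    (μ : E2 → ℝ) (μrad : ℝ → ℝ) (ρ : ℝ) (f : E2 → E2) (frad : ℝ → ℝ)
    (hμ : MuHyp μ μrad ρ) (hf : FHyp f frad)
    (a : ℝ → ℝ) (a0 : ℝ) (ha0 : ∀ ε : ℝ, 0 < ε → 0 ≤ a ε)
    (haB : ∃ C : ℝ, ∀ ε : ℝ, 0 < ε → a ε ≤ C)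
    (halim : Tendsto a (𝓝[>] (0:ℝ)) (𝓝 a0))
    (v : ℝ → E2 → E2) (hv : ∀ ε : ℝ, 0 < ε → IsMinimizer ε (a ε) μ f (v ε))
    (e : E2) (he : ‖e‖ = 1)
    (μ1 : ℝ) (hμ1 : μ1 = deriv μrad ρ)
    (w : ℝ → E2 → E2)
    (hw : ∀ (ε : ℝ) (s : E2), w ε s =
      ((2:ℝ)^(-(1/2:ℝ)) * (-μ1*ε)^(-(1/3:ℝ))) •
        v ε (ρ • e + (ε^((2:ℝ)/3) / (-μ1)^((1:ℝ)/3)) • (s 0 • e + s 1 • perp e)))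
    (εs : ℕ → ℝ) (hεpos : ∀ n, 0 < εs n) (hεlim : Tendsto εs atTop (𝓝 (0:ℝ))) :
    ∃ φ : ℕ → ℕ, StrictMono φ ∧ ∃ y : E2 → E2,
      (∀ s : E2,
        lap y s - s 0 • y s - (2 * ‖y s‖^2) • y s - (a0 / (Real.sqrt 2 * μ1)) • f (ρ • e) = 0) ∧
      TendstoC2LocSeq (fun n => w (εs (φ n))) y ∧
      (∀ s₀ : ℝ, ∃ C : ℝ, ∀ s : E2, s₀ ≤ s 0 → ‖y s‖ ≤ C) := by
  have hρ := hμ.rho_pos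
  have hm : μ1 < 0 := hμ1 ▸ hμ.deriv_neg ρ hρ
  have hm' : 0 < -μ1 := by linarith
  obtain ⟨ε0, hε0, h_intg⟩ := dens_integrable hμ hf.smooth.continuous
  obtain ⟨Ca, hCa⟩ := haB
  have hLlim : Tendsto (fun n => (εs n)^((2:ℝ)/3) / (-μ1)^((1:ℝ)/3)) atTop (𝓝 0) := by
    have := (hεlim.rpow_const (p := (2:ℝ)/3) (Or.inr (by norm_num))).div_const ((-μ1)^((1:ℝ)/3))
    rwa [Real.zero_rpow (by norm_num), zero_div] at this
  have hev : ∀ᶠ n in atTop, εs n < ε0 ∧ (εs n)^((2:ℝ)/3) / (-μ1)^((1:ℝ)/3) < 1 :=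
    (hεlim.eventually (gt_mem_nhds hε0)).and (hLlim.eventually (gt_mem_nhds one_pos))
  obtain ⟨N, hN⟩ := eventually_atTop.1 hev
  have hshift : Tendsto (fun n : ℕ => n + N) atTop atTop := tendsto_add_atTop_nat N
  let E : ℕ → ℝ := fun n => εs (n + N)
  have hE : ∀ n, 0 < E n := fun n => hεpos _
  have hEb : ∀ n, E n < ε0 := fun n => (hN _ (Nat.le_add_left N n)).1
  let l : ℕ → ℝ := fun n => (E n)^((2:ℝ)/3) / (-μ1)^((1:ℝ)/3)
  let κ : ℕ → ℝ := fun n => (2:ℝ)^(-(1/2:ℝ)) * (-μ1*E n)^(-(1/3:ℝ))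
  have hl0 : ∀ n, 0 < l n := fun n => (scal_facts (hE n) hm').1
  have hl1 : ∀ n, |l n| ≤ 1 := fun n => by
    rw [abs_of_pos (hl0 n)]; exact (hN _ (Nat.le_add_left N n)).2.le
  have hllim : Tendsto l atTop (𝓝 0) := hLlim.comp hshift
  have hsol : ∀ n, IsSolution (E n) (a (E n)) μ f (v (E n)) := fun n =>
    min_solution (hE n) hμ.smooth hf.smooth (hv _ (hE n)) (h_intg _ _ _ (hE n) (hEb n) (hv _ (hE n)))
  have hW : ∀ n, w (E n) = fun s => κ n • v (E n) (ρ • e + l n • rot e s) := fun n =>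
    funext fun s => hw (E n) s
  have hp0 : μ (ρ • e) = 0 := by rw [mu_line hμ he, hμ.rho_root]
  have haE : Tendsto (fun n => a (E n)) atTop (𝓝 a0) := by
    refine halim.comp (tendsto_nhdsWithin_iff.2 ⟨hεlim.comp hshift, Filter.Eventually.of_forall hE⟩)
  have hrb : ∀ n, |a (E n) / (√2 * μ1)| ≤ Ca / |√2 * μ1| := fun n => by
    rw [abs_div, abs_of_nonneg (ha0 _ (hE n))]
    exact div_le_div_of_nonneg_right (hCa _ (hE n)) (abs_nonneg _)
  obtain ⟨φ, hφ, y, hy, sy, hye⟩ := compactness (W := fun n => w (E n))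
    (c := fun n s => (1 / (μ1 * l n)) • μ (ρ • e + l n • rot e s))
    (h := fun n s => (a (E n) / (√2 * μ1)) • f (ρ • e + l n • rot e s))
    (c' := fun s => s 0) (h' := fun _ => (a0 / (√2 * μ1)) • f (ρ • e))
    (fun n => by rw [hW]; exact affine_smooth (hsol n).1 _ _ _ _)
    (fun n => affine_smooth hμ.smooth _ _ _ _)
    (fun n => affine_smooth hf.smooth _ _ _ _)
    (coef_LBk hμ.smooth _ hp0 l hl1 hl0 _ μ1 1)
    (affine_LBk _ l hl1 _ 2 hf.smooth hrb)
    (fun n s => by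
      obtain ⟨q1, q2, q3, q4⟩ := scal_facts (hE n) hm'
      have := rescaled_eq (hsol n) (hE n) hm q1 q2 q3 q4 (ρ • e) he s
      rw [hW]
      exact this)
    (fun s => by rw [hμ1]; exact coef_tendsto hμ he l hl0 hllim s)
    (fun s => by
      refine (haE.div_const _).smul ?_
      have h1 : Tendsto (fun n => ρ • e + l n • rot e s) atTop (𝓝 (ρ • e)) := by
        have := (hllim.smul_const (rot e s)).const_add (ρ • e)
        simpa using this
      exact (hf.smooth.continuous.tendsto _).comp h1)
  refine ⟨fun n => φ n + N, fun i j hij => Nat.add_lt_add_right (hφ hij) N, y, fun s => ?_, hy, ?_⟩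
  · have h1 : lap y s = lapV y s := rfl
    rw [h1, hye s]
    module
  · exact halfplane sy _ hye
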